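/- Let X be a real Banach space and suppose Ψ and Φ satisfy (Ψ1), (Ψ2), (Ψ3), (Φ1), (Φ2), (IB), the evenness condition (E), and the uniform symmetric mountain pass geometry (SMP). Then I := I_1 = Ψ − Φ admits infinitely many critical points {u_k}_{k≥1} ⊂ X with I(u_k) = c_k(1) for every k and c_k(1) → ∞ as k → ∞. -/

import Mathlib

open Set Filter Metric Bornology Topology

noncomputable section

variable {X : Type*} [NormedAddCommGroup X] [NormedSpace ℝ X]

/-- The functional `I_λ = λΨ − Φ`, with extended-real values. -/
def ILam (Ψ : X → EReal) (Φ : X → ℝ) (lam : ℝ) (u : X) : EReal :=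
  (lam : EReal) * Ψ u - ((Φ u : ℝ) : EReal)

/-- `u` is a critical point of `I_λ = λΨ − Φ` in the sense of Szulkin. -/
def IsCriticalPoint (Ψ : X → EReal) (Φ : X → ℝ) (lam : ℝ) (u : X) : Prop :=
  ∀ v : X, 0 ≤ (lam : EReal) * (Ψ v - Ψ u) - ((fderiv ℝ Φ u (v - u) : ℝ) : EReal)

/-- The class `Γ_k` of odd continuous maps on the closed unit disk `𝔻^k ⊂ ℝ^k`
coinciding with `π` on the boundary sphere `∂𝔻^k`. -/
def SMPClass (k : ℕ) (π : EuclideanSpace ℝ (Fin k) → X) :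
    Set (EuclideanSpace ℝ (Fin k) → X) :=
  {γ | ContinuousOn γ (closedBall 0 1) ∧
    (∀ ζ ∈ closedBall (0 : EuclideanSpace ℝ (Fin k)) 1, γ (-ζ) = - γ ζ) ∧
    (∀ ζ ∈ sphere (0 : EuclideanSpace ℝ (Fin k)) 1, γ ζ = π ζ)}

/-- The minimax value `c_k(λ) = inf_{γ ∈ Γ_k} sup_{ζ ∈ 𝔻^k} I_λ(γ(ζ))`,
expressed as the infimum of the set of real upper bounds of `I_λ ∘ γ` over `γ ∈ Γ_k`. -/
def smpValue (Ψ : X → EReal) (Φ : X → ℝ) (k : ℕ)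
    (π : EuclideanSpace ℝ (Fin k) → X) (lam : ℝ) : ℝ :=
  sInf {x : ℝ | ∃ γ ∈ SMPClass k π,
    ∀ ζ ∈ closedBall (0 : EuclideanSpace ℝ (Fin k)) 1, ILam Ψ Φ lam (γ ζ) ≤ (x : EReal)}


namespace SMPTop

abbrev V := ℕ → ℝ
abbrev Ch := List V →₀ ZMod 2

def bdL : List V → Ch
  | [] => 0
  | v :: l => Finsupp.single l 1 + Finsupp.lmapDomain (ZMod 2) (ZMod 2) (List.cons v) (bdL l)

def bd : Ch →ₗ[ZMod 2] Ch := Finsupp.linearCombination (ZMod 2) bdL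

def consL (v : V) : Ch →ₗ[ZMod 2] Ch := Finsupp.lmapDomain (ZMod 2) (ZMod 2) (List.cons v)

def mapL (f : V → V) : Ch →ₗ[ZMod 2] Ch := Finsupp.lmapDomain (ZMod 2) (ZMod 2) (List.map f)

@[simp] lemma bd_single (l : List V) : bd (Finsupp.single l 1) = bdL l := by
  simp [bd]

@[simp] lemma consL_single (v : V) (l : List V) :
    consL v (Finsupp.single l 1) = Finsupp.single (v :: l) 1 := by
  simp [consL]

@[simp] lemma mapL_single (f : V → V) (l : List V) :
    mapL f (Finsupp.single l 1) = Finsupp.single (l.map f) 1 := by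
  simp [mapL]

lemma bdL_nil : bdL [] = 0 := rfl
lemma bdL_cons (v : V) (l : List V) : bdL (v :: l) = Finsupp.single l 1 + consL v (bdL l) := rfl

/-- Extensionality for chains: two linear maps agreeing on lists are equal. -/
lemma lin_ext {M : Type*} [AddCommMonoid M] [Module (ZMod 2) M] {f g : Ch →ₗ[ZMod 2] M}
    (h : ∀ l, f (Finsupp.single l 1) = g (Finsupp.single l 1)) : f = g := by
  apply Finsupp.lhom_ext'
  intro a
  ext
  simpa using h a

lemma ch_add_self (x : Ch) : x + x = 0 := by
  ext l
  simp only [Finsupp.coe_add, Pi.add_apply, Finsupp.coe_zero, Pi.zero_apply]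
  exact CharTwo.add_self_eq_zero _

lemma bd_consL (v : V) (x : Ch) : bd (consL v x) = x + consL v (bd x) := by
  have : bd ∘ₗ consL v = LinearMap.id + consL v ∘ₗ bd := by
    apply lin_ext
    intro l
    simp [bdL_cons]
  exact LinearMap.congr_fun this x

lemma bd_bd (x : Ch) : bd (bd x) = 0 := by
  have : bd ∘ₗ bd = 0 := by
    apply lin_ext
    intro l
    simp only [LinearMap.comp_apply, bd_single, LinearMap.zero_apply]
    induction l with
    | nil => simp [bdL_nil]
    | cons v l ih =>
      rw [bdL_cons, map_add, bd_single, bd_consL, ih]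
      simp [ch_add_self]
  exact LinearMap.congr_fun this x

lemma mapL_consL (f : V → V) (v : V) (x : Ch) : mapL f (consL v x) = consL (f v) (mapL f x) := by
  have : mapL f ∘ₗ consL v = consL (f v) ∘ₗ mapL f := by
    apply lin_ext
    intro l
    simp
  exact LinearMap.congr_fun this x

lemma bd_mapL (f : V → V) (x : Ch) : bd (mapL f x) = mapL f (bd x) := by
  have : bd ∘ₗ mapL f = mapL f ∘ₗ bd := by
    apply lin_ext
    intro l
    simp only [LinearMap.comp_apply, bd_single, mapL_single]
    induction l with
    | nil => simp [bdL_nil]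
    | cons v l ih => simp [bdL_cons, ih, mapL_consL]
  exact LinearMap.congr_fun this x

/-- prism -/
def prL (f g : V → V) : List V → Ch
  | [] => 0
  | v :: l => Finsupp.single (f v :: g v :: l.map g) 1 + consL (f v) (prL f g l)

def pr (f g : V → V) : Ch →ₗ[ZMod 2] Ch := Finsupp.linearCombination (ZMod 2) (prL f g)

@[simp] lemma pr_single (f g : V → V) (l : List V) : pr f g (Finsupp.single l 1) = prL f g l := by
  simp [pr]

lemma pr_consL (f g : V → V) (v : V) (x : Ch) :
    pr f g (consL v x) = consL (f v) (consL (g v) (mapL g x)) + consL (f v) (pr f g x) := by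
  have : pr f g ∘ₗ consL v = consL (f v) ∘ₗ consL (g v) ∘ₗ mapL g + consL (f v) ∘ₗ pr f g := by
    apply lin_ext
    intro l
    simp [prL]
  exact LinearMap.congr_fun this x

lemma bd_pr (f g : V → V) (x : Ch) :
    bd (pr f g x) = mapL f x + mapL g x + pr f g (bd x) := by
  have : bd ∘ₗ pr f g = mapL f + mapL g + pr f g ∘ₗ bd := by
    apply lin_ext
    intro l
    simp only [LinearMap.comp_apply, LinearMap.add_apply, bd_single, mapL_single, pr_single]
    induction l with
    | nil => simp [bdL_nil, prL, ch_add_self]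
    | cons v l ih =>
      rw [bdL_cons, map_add, pr_single, pr_consL, prL, map_add, bd_single, bd_consL, ih]
      have h2 : mapL g (bdL l) = bdL (l.map g) := by
        have := bd_mapL g (Finsupp.single l 1)
        simpa using this.symm
      rw [bdL_cons, bdL_cons, h2]
      simp only [map_add, consL_single, List.map_cons]
      have h3 := ch_add_self (Finsupp.single (f v :: l.map g) (1 : ZMod 2))
      generalize consL (f v) (pr f g (bdL l)) = A
      generalize consL (f v) (consL (g v) (bdL (List.map g l))) = B
      generalize Finsupp.single (f v :: l.map g) (1 : ZMod 2) = C at h3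
      generalize prL f g l = D'
      generalize Finsupp.single (g v :: l.map g) (1 : ZMod 2) = E'
      generalize Finsupp.single (f v :: l.map f) (1 : ZMod 2) = G'
      calc _ = (C + C) + (G' + E' + (D' + (B + A))) := by abel
        _ = _ := by rw [h3, zero_add]
  exact LinearMap.congr_fun this x

/-- evaluation -/
def ev (F : List V → ZMod 2) : Ch →ₗ[ZMod 2] ZMod 2 := Finsupp.linearCombination (ZMod 2) F

@[simp] lemma ev_single (F : List V → ZMod 2) (l : List V) : ev F (Finsupp.single l 1) = F l := by
  simp [ev]

def chiH (χ : V → ZMod 2) : List V → ZMod 2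
  | [v] => χ v
  | _ => 0

def W (χ : V → ZMod 2) : List (V → ZMod 2) → List V → ZMod 2
  | [], l => ev (chiH χ) (bdL l)
  | s :: ss, (u :: v :: l) => (s u + s v) * W χ ss (v :: l)
  | _ :: _, [] => 0
  | _ :: _, [_] => 0

def cup (s : V → ZMod 2) (F : List V → ZMod 2) : List V → ZMod 2
  | [] => 0
  | v :: l => s v * F (v :: l)

lemma ev_cup_consL (s : V → ZMod 2) (F : List V → ZMod 2) (v : V) (x : Ch) :
    ev (cup s F) (consL v x) = s v * ev F (consL v x) := by
  have : ev (cup s F) ∘ₗ consL v = (s v) • (ev F ∘ₗ consL v) := by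
    apply lin_ext
    intro l
    simp [cup]
  simpa using LinearMap.congr_fun this x

lemma key (χ : V → ZMod 2) (ss : List (V → ZMod 2)) :
    (∀ x, ev (W χ ss) (bd x) = 0) ∧
    (∀ s x, ev (cup s (W χ ss)) (bd x) = ev (W χ (s :: ss)) x) := by
  have step : ∀ ss : List (V → ZMod 2), (∀ x, ev (W χ ss) (bd x) = 0) →
      (∀ s x, ev (cup s (W χ ss)) (bd x) = ev (W χ (s :: ss)) x) := by
    intro ss h s x
    have : ev (cup s (W χ ss)) ∘ₗ bd = ev (W χ (s :: ss)) := by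
      apply lin_ext
      intro l
      simp only [LinearMap.comp_apply, bd_single, ev_single]
      match l with
      | [] => simp [bdL_nil, W]
      | [u] => simp [bdL_nil, bdL_cons, W, cup]
      | u :: v :: l =>
        have h1 := h (Finsupp.single (u :: v :: l) 1)
        rw [bd_single, bdL_cons, map_add, ev_single] at h1
        rw [bdL_cons, map_add, ev_single, ev_cup_consL, cup, W]
        have h2 := eq_neg_of_add_eq_zero_right h1
        rw [h2, CharTwo.neg_eq]
        ring
    exact LinearMap.congr_fun this x
  induction ss with
  | nil =>
    have h0 : ∀ x, ev (W χ []) (bd x) = 0 := by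
      intro x
      have : ev (W χ []) = ev (chiH χ) ∘ₗ bd := by
        apply lin_ext
        intro l
        simp [W]
      rw [this, LinearMap.comp_apply, bd_bd, map_zero]
    exact ⟨h0, step _ h0⟩
  | cons s ss ih =>
    have h0 : ∀ x, ev (W χ (s :: ss)) (bd x) = 0 := by
      intro x
      rw [← ih.2, bd_bd, map_zero]
    exact ⟨h0, step _ h0⟩

lemma W_nil_pair (χ : V → ZMod 2) (u v : V) : W χ [] [u, v] = χ v + χ u := by
  simp [W, bdL, chiH]

lemma W_nil_long (χ : V → ZMod 2) (u v w : V) (l : List V) : W χ [] (u :: v :: w :: l) = 0 := by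
  have hh : ∀ x : Ch, ∀ a b : V, ev (chiH χ) (consL a (consL b x)) = 0 := by
    intro x a b
    have : ev (chiH χ) ∘ₗ consL a ∘ₗ consL b = 0 := by
      apply lin_ext
      intro l
      simp [chiH]
    exact LinearMap.congr_fun this x
  rw [W, bdL_cons, bdL_cons, map_add, map_add, map_add, hh]
  simp [chiH]

/-- `W` vanishes on lists of wrong length / when `χ` is constant. -/
lemma W_const_chi (χ : V → ZMod 2) (c : ZMod 2) (ss : List (V → ZMod 2)) (l : List V)
    (hl : 2 ≤ l.length) (hc : ∀ v ∈ l, χ v = c) : W χ ss l = 0 := by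
  induction ss generalizing l with
  | nil =>
    match l, hl with
    | [u, v], _ =>
      rw [W_nil_pair, hc u (by simp), hc v (by simp)]
      exact CharTwo.add_self_eq_zero _
    | u :: v :: w :: l, _ => exact W_nil_long ..
  | cons s ss ih =>
    match l, hl with
    | [u, v], _ =>
      rw [W]
      have : W χ ss [v] = 0 := by
        cases ss with
        | nil => simp [W, bdL, chiH]
        | cons => rfl
      simp [this]
    | u :: v :: w :: l, _ =>
      rw [W, ih (v :: w :: l) (by simp) (fun x hx => hc x (by simp_all)), mul_zero]

lemma W_short (χ : V → ZMod 2) (ss : List (V → ZMod 2)) (l : List V)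
    (hl : l.length < 2) : W χ ss l = 0 := by
  match l, hl with
  | [], _ => cases ss with
    | nil => simp [W, bdL]
    | cons => rfl
  | [u], _ => cases ss with
    | nil => simp [W, bdL, chiH]
    | cons => rfl

lemma W_const_chi' (χ : V → ZMod 2) (c : ZMod 2) (ss : List (V → ZMod 2)) (l : List V)
    (hc : ∀ v ∈ l, χ v = c) : W χ ss l = 0 := by
  rcases lt_or_ge l.length 2 with h | h
  · exact W_short _ _ _ h
  · exact W_const_chi χ c ss l h hc

lemma W_const_s (χ : V → ZMod 2) (s : V → ZMod 2) (c : ZMod 2) (ss : List (V → ZMod 2)) (l : List V)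
    (hs : s ∈ ss) (hc : ∀ v ∈ l, s v = c) : W χ ss l = 0 := by
  induction ss generalizing l with
  | nil => simp at hs
  | cons s' ss ih =>
    match l with
    | [] => rfl
    | [u] => rfl
    | u :: v :: l =>
      rw [W]
      rcases List.mem_cons.1 hs with rfl | h
      · rw [hc u (by simp), hc v (by simp), CharTwo.add_self_eq_zero, zero_mul]
      · rw [ih (v :: l) h (fun x hx => hc x (by simp_all)), mul_zero]

lemma W_inv (χ : V → ZMod 2) (ss : List (V → ZMod 2)) (l : List V)
    (hχ : ∀ v, χ (-v) = χ v) (hss : ∀ s ∈ ss, ∀ v ∈ l, s (-v) = s v + 1) :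
    W χ ss (l.map (fun v => -v)) = W χ ss l := by
  induction ss generalizing l with
  | nil =>
    match l with
    | [] => rfl
    | [u] => simp [W, bdL, chiH]
    | [u, v] => simp [W_nil_pair, hχ]
    | u :: v :: w :: l => rw [List.map_cons, List.map_cons, List.map_cons, W_nil_long, W_nil_long]
  | cons s' ss ih =>
    match l with
    | [] => rfl
    | [u] => rfl
    | u :: v :: l =>
      have := ih (v :: l) (fun s hs x hx => hss s (by simp [hs]) x (by simp_all))
      simp only [List.map_cons] at this ⊢
      rw [W, W, this, hss s' (by simp) u (by simp), hss s' (by simp) v (by simp)]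
      have h1 : s' u + 1 + (s' v + 1) = s' u + s' v + (1 + 1) := by ring
      rw [h1, CharTwo.add_self_eq_zero, add_zero]

end SMPTop
namespace SMPTop

def Spt (P : List V → Prop) : Submodule (ZMod 2) Ch := Finsupp.supported (ZMod 2) (ZMod 2) {l | P l}

lemma single_mem_Spt {P : List V → Prop} {l : List V} (h : P l) :
    (Finsupp.single l 1 : Ch) ∈ Spt P := Finsupp.single_mem_supported _ _ h

lemma Spt_map {P : List V → Prop} {M : Type*} [AddCommMonoid M] [Module (ZMod 2) M]
    (S : Submodule (ZMod 2) M) (L : Ch →ₗ[ZMod 2] M)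
    (h : ∀ l, P l → L (Finsupp.single l 1) ∈ S) {x : Ch} (hx : x ∈ Spt P) : L x ∈ S := by
  have : Spt P ≤ S.comap L := by
    rw [Spt, Finsupp.supported_eq_span_single, Submodule.span_le]
    rintro _ ⟨l, hl, rfl⟩
    exact h l hl
  exact this hx

lemma Spt_mono {P Q : List V → Prop} (h : ∀ l, P l → Q l) : Spt P ≤ Spt Q :=
  Finsupp.supported_mono h

lemma ev_zero {P : List V → Prop} {F : List V → ZMod 2} (h : ∀ l, P l → F l = 0) {x : Ch}
    (hx : x ∈ Spt P) : ev F x = 0 := by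
  have := Spt_map (P := P) ⊥ (ev F) (fun l hl => by simp [h l hl]) hx
  simpa using this

lemma prL_supp (f g : V → V) (l : List V) :
    prL f g l ∈ Spt (fun l' => ∀ x ∈ l', ∃ v ∈ l, x = f v ∨ x = g v) := by
  induction l with
  | nil => exact Submodule.zero_mem _
  | cons v l ih =>
    rw [prL]
    apply Submodule.add_mem
    · apply single_mem_Spt
      intro x hx
      simp only [List.mem_cons, List.mem_map] at hx
      rcases hx with rfl | rfl | ⟨w, hw, rfl⟩
      · exact ⟨v, by simp, Or.inl rfl⟩
      · exact ⟨v, by simp, Or.inr rfl⟩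
      · exact ⟨w, by simp [hw], Or.inr rfl⟩
    · refine Spt_map _ (consL (f v)) (fun l' hl' => ?_) ih
      rw [consL_single]
      apply single_mem_Spt
      intro x hx
      rcases List.mem_cons.1 hx with rfl | hx
      · exact ⟨v, by simp, Or.inl rfl⟩
      · obtain ⟨w, hw, h⟩ := hl' x hx
        exact ⟨w, by simp [hw], h⟩

def up (i : ℕ) (a : ℝ) (v : V) : V := Function.update v i a

def hh (N j : ℕ) : Ch →ₗ[ZMod 2] Ch :=
  ∑ n ∈ Finset.range N, pr (up j ((n : ℝ) / N)) (up j (((n + 1 : ℕ) : ℝ) / N))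

def ng : Ch →ₗ[ZMod 2] Ch := mapL (fun v => -v)

def D (N : ℕ) : ℕ → Ch
  | 0 => Finsupp.single [0] 1
  | j + 1 => hh N j (D N j) + ng (hh N j (D N j))

lemma ng_ng (x : Ch) : ng (ng x) = x := by
  have : ng ∘ₗ ng = LinearMap.id := by
    apply lin_ext
    intro l
    simp [ng]
  exact LinearMap.congr_fun this x

lemma ng_D (N j : ℕ) : ng (D N j) = D N j := by
  cases j with
  | zero => simp [D, ng]
  | succ j => rw [D, map_add, ng_ng, add_comm]

lemma bd_hh (N j : ℕ) (hN : 0 < N) (x : Ch) :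
    bd (hh N j x) = mapL (up j 0) x + mapL (up j 1) x + hh N j (bd x) := by
  have h : ∀ M : ℕ, bd ((∑ n ∈ Finset.range M, pr (up j ((n : ℝ) / N))
      (up j (((n + 1 : ℕ) : ℝ) / N))) x) = mapL (up j 0) x + mapL (up j ((M : ℝ) / N)) x +
      (∑ n ∈ Finset.range M, pr (up j ((n : ℝ) / N)) (up j (((n + 1 : ℕ) : ℝ) / N))) (bd x) := by
    intro M
    induction M with
    | zero => simp [ch_add_self]
    | succ M ih =>
      rw [Finset.sum_range_succ, LinearMap.add_apply, LinearMap.add_apply, map_add, ih, bd_pr]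
      have h3 := ch_add_self (mapL (up j ((M : ℝ) / N)) x)
      generalize mapL (up j ((M : ℝ) / N)) x = A at h3 ⊢
      generalize mapL (up j (((M + 1 : ℕ) : ℝ) / N)) x = B
      generalize (pr (up j (↑M / ↑N)) (up j (↑(M + 1) / ↑N))) (bd x) = C
      generalize (∑ n ∈ Finset.range M, pr (up j ((n : ℝ) / N)) (up j (((n + 1 : ℕ) : ℝ) / N))) (bd x) = E'
      generalize mapL (up j 0) x = G'
      calc _ = (A + A) + (G' + B + (E' + C)) := by abel
        _ = _ := by rw [h3, zero_add]
  have := h N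
  rw [div_self (by positivity)] at this
  exact this

def Small (N j : ℕ) (l : List V) : Prop :=
  (∀ v ∈ l, (∀ i, |v i| ≤ 1) ∧ ∀ i, j ≤ i → v i = 0) ∧
    ∀ v ∈ l, ∀ w ∈ l, ∀ i, |v i - w i| ≤ 1 / N

def Outer (j : ℕ) (l : List V) : Prop := ∀ v ∈ l, ∃ i < j, |v i| = 1

lemma hh_small (N j : ℕ) {x : Ch} (hx : x ∈ Spt (Small N j)) :
    hh N j x ∈ Spt (Small N (j + 1)) := by
  rw [hh, LinearMap.sum_apply]
  apply Submodule.sum_mem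
  intro n hn
  have hn' : n + 1 ≤ N := Finset.mem_range.1 hn
  have hN : (0 : ℝ) < N := by
    have : 0 < N := by omega
    exact_mod_cast this
  have hn1 : ((n : ℝ) + 1) ≤ N := by exact_mod_cast hn'
  have ha : |(n : ℝ) / N| ≤ 1 := by
    rw [abs_of_nonneg (by positivity), div_le_one hN]; linarith
  have hb : |((n + 1 : ℕ) : ℝ) / N| ≤ 1 := by
    rw [abs_of_nonneg (by positivity), div_le_one hN]; push_cast; linarith
  have hab : ((n + 1 : ℕ) : ℝ) / N - (n : ℝ) / N = 1 / N := by
    push_cast; field_simp; ring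
  refine Spt_map _ _ (fun l hl => ?_) hx
  rw [pr_single]
  refine Spt_mono ?_ (prL_supp _ _ l)
  intro l' hl'
  have e1 : ∀ x ∈ l', ∃ v ∈ l, ∃ a, (a = (n : ℝ) / N ∨ a = ((n + 1 : ℕ) : ℝ) / N) ∧ x = up j a v := by
    intro x hx
    obtain ⟨v, hv, h⟩ := hl' x hx
    rcases h with h | h
    · exact ⟨v, hv, _, Or.inl rfl, h⟩
    · exact ⟨v, hv, _, Or.inr rfl, h⟩
  constructor
  · intro x hx
    obtain ⟨v, hv, a, ha', rfl⟩ := e1 x hx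
    constructor
    · intro i
      by_cases hi : i = j
      · subst hi
        simp only [up, Function.update_self]
        rcases ha' with rfl | rfl
        exacts [ha, hb]
      · simpa [up, hi] using (hl.1 v hv).1 i
    · intro i hi
      have : i ≠ j := by omega
      simpa [up, this] using (hl.1 v hv).2 i (by omega)
  · intro x hx y hy i
    obtain ⟨v, hv, a, ha', rfl⟩ := e1 x hx
    obtain ⟨w, hw, b, hb', rfl⟩ := e1 y hy
    by_cases hi : i = j
    · subst hi
      simp only [up, Function.update_self]
      have : (0 : ℝ) ≤ 1 / N := by positivity
      rcases ha' with rfl | rfl <;> rcases hb' with rfl | rfl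
      · simpa using this
      · rw [abs_sub_comm, hab, abs_of_nonneg this]
      · rw [hab, abs_of_nonneg this]
      · simpa using this
    · simpa [up, hi] using hl.2 v hv w hw i

lemma ng_small (N j : ℕ) {x : Ch} (hx : x ∈ Spt (Small N j)) : ng x ∈ Spt (Small N j) := by
  refine Spt_map _ _ (fun l hl => ?_) hx
  rw [ng, mapL_single]
  apply single_mem_Spt
  constructor
  · intro x hx
    obtain ⟨v, hv, rfl⟩ := List.mem_map.1 hx
    exact ⟨fun i => by simpa using (hl.1 v hv).1 i, fun i hi => by simpa using (hl.1 v hv).2 i hi⟩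
  · intro x hx y hy i
    obtain ⟨v, hv, rfl⟩ := List.mem_map.1 hx
    obtain ⟨w, hw, rfl⟩ := List.mem_map.1 hy
    have := hl.2 w hw v hv i
    have e : (-v) i - (-w) i = w i - v i := by simp; ring
    rw [e]; exact this

lemma D_small (N j : ℕ) : D N j ∈ Spt (Small N j) := by
  induction j with
  | zero =>
    apply single_mem_Spt
    constructor <;> simp
  | succ j ih => exact Submodule.add_mem _ (hh_small N j ih) (ng_small _ _ (hh_small N j ih))

lemma ng_outer (j : ℕ) {x : Ch} (hx : x ∈ Spt (Outer j)) : ng x ∈ Spt (Outer j) := by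
  refine Spt_map _ _ (fun l hl => ?_) hx
  rw [ng, mapL_single]
  apply single_mem_Spt
  intro x hx
  obtain ⟨v, hv, rfl⟩ := List.mem_map.1 hx
  obtain ⟨i, hi, h⟩ := hl v hv
  exact ⟨i, hi, by simpa using h⟩

lemma hh_outer (N j : ℕ) {x : Ch} (hx : x ∈ Spt (Outer j)) : hh N j x ∈ Spt (Outer (j + 1)) := by
  rw [hh, LinearMap.sum_apply]
  apply Submodule.sum_mem
  intro n hn
  refine Spt_map _ _ (fun l hl => ?_) hx
  rw [pr_single]
  refine Spt_mono ?_ (prL_supp _ _ l)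
  intro l' hl' x hx
  obtain ⟨v, hv, h⟩ := hl' x hx
  obtain ⟨i, hi, h1⟩ := hl v hv
  have : i ≠ j := by omega
  refine ⟨i, by omega, ?_⟩
  rcases h with rfl | rfl <;> simpa [up, this] using h1

lemma mapL_up_zero (N j : ℕ) : mapL (up j 0) (D N j) = D N j := by
  have : mapL (up j 0) (D N j) - D N j ∈ (⊥ : Submodule (ZMod 2) Ch) := by
    refine Spt_map (P := Small N j) ⊥ (mapL (up j 0) - LinearMap.id) (fun l hl => ?_) (D_small N j)
    have : l.map (up j 0) = l := by
      conv_rhs => rw [← List.map_id l]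
      apply List.map_congr_left
      intro v hv
      ext i
      by_cases hi : i = j
      · subst hi; simp [up, (hl.1 v hv).2 i le_rfl]
      · simp [up, hi]
    simp [this]
  exact sub_eq_zero.1 (by simpa using this)

lemma mapL_up_one (j : ℕ) (x : Ch) : mapL (up j 1) x ∈ Spt (Outer (j + 1)) := by
  refine Spt_map (P := fun _ => True) _ (mapL (up j 1)) (fun l _ => ?_)
    (by simp [Spt, Finsupp.supported_univ])
  rw [mapL_single]
  apply single_mem_Spt
  intro x hx
  obtain ⟨v, hv, rfl⟩ := List.mem_map.1 hx
  exact ⟨j, by omega, by simp [up]⟩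

lemma bd_D_outer (N j : ℕ) (hN : 0 < N) : bd (D N j) ∈ Spt (Outer j) ∧
    ∃ E ∈ Spt (Outer (j + 1)), bd (hh N j (D N j)) = D N j + E := by
  have step : ∀ j, bd (D N j) ∈ Spt (Outer j) →
      ∃ E ∈ Spt (Outer (j + 1)), bd (hh N j (D N j)) = D N j + E := by
    intro j hj
    refine ⟨mapL (up j 1) (D N j) + hh N j (bd (D N j)),
      Submodule.add_mem _ (mapL_up_one _ _) (hh_outer N j hj), ?_⟩
    rw [bd_hh N j hN, mapL_up_zero, add_assoc]
  induction j with
  | zero =>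
    have h0 : bd (D N 0) ∈ Spt (Outer 0) := by
      rw [D, bd_single, bdL_cons, bdL_nil, map_zero, add_zero]
      apply single_mem_Spt
      intro v hv
      simp at hv
    exact ⟨h0, step 0 h0⟩
  | succ j ih =>
    have h0 : bd (D N (j + 1)) ∈ Spt (Outer (j + 1)) := by
      obtain ⟨E, hE, h⟩ := ih.2
      rw [D, map_add, ng, bd_mapL, ← ng, h, map_add, ng_D]
      have : D N j + E + (D N j + ng E) = (D N j + D N j) + (E + ng E) := by abel
      rw [this, ch_add_self, zero_add]
      exact Submodule.add_mem _ hE (ng_outer _ hE)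
    exact ⟨h0, step _ h0⟩

/-- The combinatorial Borsuk-Ulam type lemma. -/
lemma comb (N : ℕ) (hN : 0 < N) (χ : V → ZMod 2) (hχ : ∀ v, χ (-v) = χ v)
    (hχ0 : ∀ v : V, (∀ i, |v i| ≤ 1 / N) → χ v = 1)
    (ss : List (V → ZMod 2)) (hss : ∀ s ∈ ss, ∀ v, v ≠ 0 → s (-v) = s v + 1)
    (hχ1 : ∀ v : V, (∃ i < ss.length + 1, |v i| = 1) → χ v = 0) :
    ∃ l, Small N (ss.length + 1) l ∧ W χ ss l ≠ 0 := by
  have main : ∀ ss' : List (V → ZMod 2), (∀ s ∈ ss', s ∈ ss) → ss'.length ≤ ss.length →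
      ev (W χ ss') (hh N ss'.length (D N ss'.length)) = 1 := by
    intro ss'
    induction ss' with
    | nil =>
      intro _ _
      obtain ⟨E, hE, h⟩ := (bd_D_outer N 0 hN).2
      have : ev (W χ []) (hh N 0 (D N 0)) = ev (chiH χ) (bd (hh N 0 (D N 0))) := by
        have : ev (W χ []) = ev (chiH χ) ∘ₗ bd := by
          apply lin_ext
          intro l
          simp [W]
        rw [this]; rfl
      rw [List.length_nil, this, h, map_add, D, ev_single, ev_zero _ hE, add_zero]
      · exact hχ0 0 (by intro i; simp)
      · intro l hl
        match l with
        | [] => rfl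
        | [v] => exact hχ1 v (by
            obtain ⟨i, hi, h⟩ := hl v (by simp)
            exact ⟨i, by omega, h⟩)
        | _ :: _ :: _ => rfl
    | cons s ss' ih =>
      intro h1 h2
      have ih' := ih (fun t ht => h1 t (by simp [ht])) (by simp at h2; omega)
      obtain ⟨E, hE, h⟩ := (bd_D_outer N (ss'.length + 1) hN).2
      rw [List.length_cons, ← (key χ ss').2, h, map_add, ev_zero _ hE, add_zero, ← ih', D, map_add]
      · have hs := hh_small N ss'.length (D_small N ss'.length)
        have : (ev (cup s (W χ ss')) ∘ₗ (LinearMap.id + ng) - ev (W χ ss') : Ch →ₗ[ZMod 2] ZMod 2)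
            (hh N ss'.length (D N ss'.length)) ∈ (⊥ : Submodule (ZMod 2) (ZMod 2)) := by
          refine Spt_map (P := Small N (ss'.length + 1)) _ _ (fun l hl => ?_) hs
          simp only [LinearMap.sub_apply, LinearMap.comp_apply, LinearMap.add_apply,
            LinearMap.id_apply, map_add, ev_single, ng, mapL_single, Submodule.mem_bot]
          by_cases h0 : (0 : V) ∈ l
          · have hc : ∀ v ∈ l, χ v = 1 := fun v hv => hχ0 v (fun i => by
              simpa using hl.2 v hv 0 h0 i)
            have hc' : ∀ v ∈ l.map (fun v => -v), χ v = 1 := by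
              intro x hx
              obtain ⟨v, hv, rfl⟩ := List.mem_map.1 hx
              rw [hχ, hc v hv]
            have z1 := W_const_chi' χ 1 ss' l hc
            have z2 := W_const_chi' χ 1 ss' _ hc'
            have c1 : ∀ l', W χ ss' l' = 0 → cup s (W χ ss') l' = 0 := by
              intro l' h
              cases l' with
              | nil => rfl
              | cons v l' => rw [cup, h, mul_zero]
            rw [c1 _ z1, c1 _ z2, z1]; simp
          · have hne : ∀ v ∈ l, v ≠ 0 := fun v hv h => h0 (h ▸ hv)
            have hi := W_inv χ ss' l hχ (fun t ht v hv => hss t (h1 t (by simp [ht])) v (hne v hv))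
            cases l with
            | nil => 
              have : W χ ss' [] = 0 := W_short _ _ _ (by simp)
              simp [cup, this]
            | cons v l =>
              rw [List.map_cons] at hi ⊢
              rw [cup, cup, hi, hss s (h1 s (by simp)) v (hne v (by simp))]
              have : s v * W χ ss' (v :: l) + (s v + 1) * W χ ss' (v :: l) - W χ ss' (v :: l) =
                (s v + s v) * W χ ss' (v :: l) := by ring
              rw [this, CharTwo.add_self_eq_zero, zero_mul]
        rw [Submodule.mem_bot] at this
        exact sub_eq_zero.1 (by simpa using this)
      · intro l hl
        have : W χ ss' l = 0 := W_const_chi' χ 0 ss' l (fun v hv => hχ1 v (by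
            obtain ⟨i, hi, h⟩ := hl v hv
            simp at h2
            exact ⟨i, by omega, h⟩))
        cases l with
        | nil => rfl
        | cons v l' => rw [cup, this, mul_zero]
  by_contra hcon
  push Not at hcon
  have h1 := main ss (fun _ h => h) le_rfl
  rw [ev_zero hcon (hh_small N _ (D_small N _))] at h1
  exact zero_ne_one h1

end SMPTop
namespace SMPTop

def tie (v : V) : Prop := ∃ i, 0 < v i ∧ ∀ k < i, v k = 0

lemma tie_neg (v : V) (hv : v ≠ 0) : tie (-v) ↔ ¬ tie v := by
  classical
  have hex : ∃ i, v i ≠ 0 := by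
    by_contra h
    push Not at h
    exact hv (funext h)
  have h1 := Nat.find_spec hex
  have h2 : ∀ k < Nat.find hex, v k = 0 := fun k hk => by
    have := Nat.find_min hex hk
    simpa using this
  constructor
  · rintro ⟨i, hi, hi'⟩ ⟨j, hj, hj'⟩
    simp at hi hi'
    rcases lt_trichotomy i j with h | h | h
    · have := hj' i h; linarith
    · subst h; linarith
    · have := hi' j h; linarith
  · intro h
    refine ⟨Nat.find hex, ?_, fun k hk => by simpa using h2 k hk⟩
    rcases lt_or_gt_of_ne h1 with h3 | h3
    · simpa using h3
    · exact absurd ⟨_, h3, h2⟩ h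

open Classical in
def sg (h : V → ℝ) (v : V) : ZMod 2 := if 0 < h v ∨ (h v = 0 ∧ tie v) then 1 else 0

lemma sg_neg (h : V → ℝ) (hh : ∀ v, h (-v) = - h v) (v : V) (hv : v ≠ 0) :
    sg h (-v) = sg h v + 1 := by
  have ht := tie_neg v hv
  have e : (1 : ZMod 2) + 1 = 0 := by decide
  unfold sg
  rw [hh]
  by_cases hp : tie v
  · have hp' : ¬ tie (-v) := by rw [ht]; simpa using hp
    rcases lt_trichotomy (h v) 0 with h1 | h1 | h1
    · have a1 : ¬ 0 < h v := by linarith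
      have a2 : h v ≠ 0 := by linarith
      simp [h1, a1, a2]
    · simp [h1, hp, hp', e]
    · have a1 : ¬ h v < 0 := by linarith
      have a2 : h v ≠ 0 := by linarith
      simp [h1, a1, a2, e]
  · have hp' : tie (-v) := by rw [ht]; simpa using hp
    rcases lt_trichotomy (h v) 0 with h1 | h1 | h1
    · have a1 : ¬ 0 < h v := by linarith
      have a2 : h v ≠ 0 := by linarith
      simp [h1, a1, a2]
    · simp [h1, hp, hp']
    · have a1 : ¬ h v < 0 := by linarith
      have a2 : h v ≠ 0 := by linarith
      simp [h1, a1, a2, e]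

lemma nonconst (s : V → ZMod 2) (l : List V) (h : ∀ c, ¬ ∀ v ∈ l, s v = c) :
    (∃ v ∈ l, s v = 1) ∧ ∃ v ∈ l, s v ≠ 1 := by
  have h0 := h 0
  have h1 := h 1
  push Not at h0 h1
  obtain ⟨v, hv, h0⟩ := h0
  refine ⟨⟨v, hv, ?_⟩, h1⟩
  generalize s v = z at h0
  revert h0
  revert z
  decide

/-- Finite precision version. -/
lemma TL_approx (m : ℕ) (hs : List ((Fin m → ℝ) → ℝ)) (hlen : hs.length < m)
    (hodd : ∀ h ∈ hs, ∀ x, h (-x) = - h x)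
    (τ : (Fin m → ℝ) → ℝ) (hτ : ∀ x, τ (-x) = τ x)
    (N : ℕ) (hN : 0 < N) (hτ0 : ∀ x : Fin m → ℝ, (∀ i, |x i| ≤ 1 / N) → τ x < 0)
    (hτ1 : ∀ x, (∃ i, |x i| = 1) → 0 < τ x) :
    ∃ x : Fin m → ℝ, (∀ i, |x i| ≤ 1) ∧
      (∃ y, (∀ i, |y i - x i| ≤ 1 / N) ∧ τ y ≤ 0) ∧ (∃ y, (∀ i, |y i - x i| ≤ 1 / N) ∧ 0 ≤ τ y) ∧
      ∀ h ∈ hs, (∃ y, (∀ i, |y i - x i| ≤ 1 / N) ∧ h y ≤ 0) ∧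
        (∃ y, (∀ i, |y i - x i| ≤ 1 / N) ∧ 0 ≤ h y) := by
  classical
  let e : V → (Fin m → ℝ) := fun v i => v i
  have he : ∀ v, e (-v) = - e v := fun v => rfl
  let χ : V → ZMod 2 := fun v => if τ (e v) < 0 then 1 else 0
  let ss : List (V → ZMod 2) := hs.map (fun h => sg (fun v => h (e v)))
  have hssl : ss.length = hs.length := by simp [ss]
  obtain ⟨l, hl, hW⟩ := comb N hN χ (fun v => by simp only [χ, he, hτ])
    (fun v hv => by
      have : τ (e v) < 0 := hτ0 _ (fun i => hv i)
      simp [χ, this]) ss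
    (by
      intro s hs' v hv
      obtain ⟨h, hh, rfl⟩ := List.mem_map.1 hs'
      exact sg_neg _ (fun v => by rw [he, hodd h hh]) v hv)
    (by
      rintro v ⟨i, hi, hv⟩
      have : 0 < τ (e v) := hτ1 _ ⟨⟨i, by omega⟩, hv⟩
      simp [χ, this.le])
  have hne : l ≠ [] := by
    rintro rfl
    exact hW (W_short _ _ _ (by simp))
  obtain ⟨v0, hv0⟩ := List.exists_mem_of_ne_nil l hne
  have hcl : ∀ v ∈ l, ∀ i, |e v i - e v0 i| ≤ 1 / N := fun v hv i => hl.2 v hv v0 hv0 i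
  refine ⟨e v0, fun i => (hl.1 v0 hv0).1 i, ?_, ?_, ?_⟩
  · obtain ⟨⟨v, hv, h1⟩, -⟩ := nonconst χ l (fun c hc => hW (W_const_chi' χ c ss l hc))
    refine ⟨e v, hcl v hv, ?_⟩
    by_contra hcon
    push Not at hcon
    simp [χ, hcon.le] at h1
  · obtain ⟨-, ⟨v, hv, h1⟩⟩ := nonconst χ l (fun c hc => hW (W_const_chi' χ c ss l hc))
    refine ⟨e v, hcl v hv, ?_⟩
    by_contra hcon
    push Not at hcon
    simp [χ, hcon] at h1
  · intro h hh
    obtain ⟨⟨v, hv, h1⟩, ⟨w, hw, h2⟩⟩ := nonconst (sg (fun v => h (e v))) l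
      (fun c hc => hW (W_const_s χ _ c ss l (List.mem_map.2 ⟨h, hh, rfl⟩) hc))
    refine ⟨⟨e w, hcl w hw, ?_⟩, ⟨e v, hcl v hv, ?_⟩⟩
    · by_contra hcon
      push Not at hcon
      simp [sg, hcon] at h2
    · by_contra hcon
      push Not at hcon
      have a1 : ¬ 0 < h (e v) := by linarith
      have a2 : h (e v) ≠ 0 := by linarith
      simp [sg, a1, a2] at h1

lemma TL_pi (m : ℕ) (hs : List ((Fin m → ℝ) → ℝ)) (hlen : hs.length < m)
    (hcont : ∀ h ∈ hs, Continuous h)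
    (hodd : ∀ h ∈ hs, ∀ x, h (-x) = - h x)
    (τ : (Fin m → ℝ) → ℝ) (hτc : Continuous τ) (hτ : ∀ x, τ (-x) = τ x)
    (hτ0 : τ 0 < 0) (hτ1 : ∀ x, (∃ i, |x i| = 1) → 0 < τ x) :
    ∃ x : Fin m → ℝ, τ x = 0 ∧ ∀ h ∈ hs, h x = 0 := by
  have hev : ∀ᶠ x in 𝓝 (0 : Fin m → ℝ), τ x < 0 := hτc.continuousAt.eventually_lt_const hτ0
  obtain ⟨r, hr, hball⟩ := Metric.eventually_nhds_iff.1 hev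
  obtain ⟨N0, hN0⟩ := exists_nat_one_div_lt hr
  have key : ∀ n : ℕ, ∃ x : Fin m → ℝ, (∀ i, |x i| ≤ 1) ∧
      (∃ y, (∀ i, |y i - x i| ≤ 1 / ((n + N0 + 1 : ℕ) : ℝ)) ∧ τ y ≤ 0) ∧
      (∃ y, (∀ i, |y i - x i| ≤ 1 / ((n + N0 + 1 : ℕ) : ℝ)) ∧ 0 ≤ τ y) ∧
      ∀ h ∈ hs, (∃ y, (∀ i, |y i - x i| ≤ 1 / ((n + N0 + 1 : ℕ) : ℝ)) ∧ h y ≤ 0) ∧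
        (∃ y, (∀ i, |y i - x i| ≤ 1 / ((n + N0 + 1 : ℕ) : ℝ)) ∧ 0 ≤ h y) := by
    intro n
    refine TL_approx m hs hlen hodd τ hτ (n + N0 + 1) (by omega) ?_ hτ1
    intro x hx
    apply hball
    have h1 : (1 : ℝ) / ((n + N0 + 1 : ℕ) : ℝ) ≤ 1 / ((N0 : ℝ) + 1) := by
      apply one_div_le_one_div_of_le (by positivity)
      push_cast
      have : (0 : ℝ) ≤ n := by positivity
      linarith
    have h2 : dist x 0 ≤ 1 / ((N0 : ℝ) + 1) := by
      rw [dist_pi_le_iff (by positivity)]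
      intro i
      simpa [Real.dist_eq] using (hx i).trans h1
    linarith
  choose x hx hτa hτb hh using key
  have hK : IsCompact (closedBall (0 : Fin m → ℝ) 1) := isCompact_closedBall _ _
  obtain ⟨x0, -, φ, hφ, hlim⟩ := hK.tendsto_subseq (x := x) (fun n => by
    rw [mem_closedBall, dist_pi_le_iff (by norm_num)]
    intro i
    simpa [Real.dist_eq] using hx n i)
  have gen : ∀ (g : (Fin m → ℝ) → ℝ) (y : ℕ → Fin m → ℝ), Continuous g →
      (∀ n i, |y n i - x n i| ≤ 1 / ((n + N0 + 1 : ℕ) : ℝ)) →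
      Tendsto (fun n => g (y (φ n))) atTop (𝓝 (g x0)) := by
    intro g y hg hy
    refine (hg.tendsto x0).comp ?_
    refine tendsto_of_tendsto_of_dist hlim ?_
    have h0 : Tendsto (fun n : ℕ => (1 : ℝ) / ((n : ℝ) + 1)) atTop (𝓝 0) :=
      tendsto_one_div_add_atTop_nhds_zero_nat
    refine squeeze_zero (fun n => dist_nonneg) (fun n => ?_) (h0.comp hφ.tendsto_atTop)
    have h1 : (1 : ℝ) / ((φ n + N0 + 1 : ℕ) : ℝ) ≤ 1 / ((φ n : ℝ) + 1) := by
      apply one_div_le_one_div_of_le (by positivity)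
      push_cast
      have : (0 : ℝ) ≤ N0 := by positivity
      linarith
    refine le_trans ?_ h1
    rw [dist_comm, dist_pi_le_iff (by positivity)]
    intro i
    rw [Real.dist_eq]
    exact hy (φ n) i
  have gen2 : ∀ g : (Fin m → ℝ) → ℝ, Continuous g →
      (∀ n, ∃ y, (∀ i, |y i - x n i| ≤ 1 / ((n + N0 + 1 : ℕ) : ℝ)) ∧ g y ≤ 0) →
      (∀ n, ∃ y, (∀ i, |y i - x n i| ≤ 1 / ((n + N0 + 1 : ℕ) : ℝ)) ∧ 0 ≤ g y) → g x0 = 0 := by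
    intro g hg ha hb
    choose y hy hy0 using ha
    choose z hz hz0 using hb
    apply le_antisymm
    · exact le_of_tendsto' (gen g y hg hy) (fun n => hy0 _)
    · exact ge_of_tendsto' (gen g z hg hz) (fun n => hz0 _)
  exact ⟨x0, gen2 τ hτc hτa hτb, fun h hhs => gen2 h (hcont h hhs) (fun n => (hh n h hhs).1)
    (fun n => (hh n h hhs).2)⟩

/-- Topological lemma on Euclidean space. -/
lemma TL (m : ℕ) (hs : List (EuclideanSpace ℝ (Fin m) → ℝ)) (hlen : hs.length < m)
    (hcont : ∀ h ∈ hs, Continuous h)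
    (hodd : ∀ h ∈ hs, ∀ x, h (-x) = - h x)
    (τ : EuclideanSpace ℝ (Fin m) → ℝ) (hτc : Continuous τ) (hτ : ∀ x, τ (-x) = τ x)
    (hτ0 : τ 0 < 0) (hτ1 : ∀ x, 1 ≤ ‖x‖ → 0 < τ x) :
    ∃ x : EuclideanSpace ℝ (Fin m), τ x = 0 ∧ ∀ h ∈ hs, h x = 0 := by
  let T : (Fin m → ℝ) → EuclideanSpace ℝ (Fin m) := WithLp.toLp 2
  have hT : Continuous T := PiLp.continuous_toLp 2 _
  have hTn : ∀ x, T (-x) = - T x := fun x => rfl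
  obtain ⟨x, h1, h2⟩ := TL_pi m (hs.map (fun h => h ∘ T)) (by simpa using hlen)
    (by
      intro h hh
      obtain ⟨g, hg, rfl⟩ := List.mem_map.1 hh
      exact (hcont g hg).comp hT)
    (by
      intro h hh x
      obtain ⟨g, hg, rfl⟩ := List.mem_map.1 hh
      simp only [Function.comp, hTn, hodd g hg])
    (τ ∘ T) (hτc.comp hT) (fun x => by simp only [Function.comp, hTn, hτ])
    hτ0 (by
      rintro x ⟨i, hi⟩
      apply hτ1
      have := PiLp.norm_apply_le (T x) i
      rw [Real.norm_eq_abs] at this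
      have h3 : (T x) i = x i := rfl
      rw [h3, hi] at this
      exact this)
  exact ⟨T x, h1, fun h hh => h2 _ (List.mem_map.2 ⟨h, hh, rfl⟩)⟩

end SMPTop
namespace SMPAn

/-- Ekeland variational principle. -/
lemma ekeland {α : Type*} [MetricSpace α] [CompleteSpace α] (S : Set α) (f : α → ℝ)
    (hcl : ∀ a, IsClosed {x | x ∈ S ∧ f x ≤ a}) (m : ℝ) (hm : ∀ x ∈ S, m ≤ f x)
    (x0 : α) (hx0 : x0 ∈ S) (σ : ℝ) (hσ : 0 < σ) :
    ∃ x ∈ S, σ * dist x0 x ≤ f x0 - f x ∧ ∀ y ∈ S, f x - σ * dist x y ≤ f y := by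
  classical
  let Q : α → Set α := fun x => {y | y ∈ S ∧ f y + σ * dist x y ≤ f x}
  have hQt : ∀ x y z, y ∈ Q x → z ∈ Q y → z ∈ Q x := by
    rintro x y z ⟨hy, h1⟩ ⟨hz, h2⟩
    refine ⟨hz, ?_⟩
    have := dist_triangle x y z
    nlinarith
  have step : ∀ (n : ℕ) (x : S), ∃ y : S, (y : α) ∈ Q x ∧ ∀ z ∈ Q x, f y ≤ f z + (1 / 2 : ℝ) ^ n := by
    intro n x
    have hne : (f '' Q x).Nonempty := ⟨f x, x, ⟨x.2, by simp⟩, rfl⟩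
    have hbd : BddBelow (f '' Q x) := ⟨m, by
      rintro _ ⟨y, hy, rfl⟩
      exact hm y hy.1⟩
    obtain ⟨_, ⟨y, hy, rfl⟩, h⟩ := exists_lt_of_csInf_lt hne
      (show sInf (f '' Q x) < sInf (f '' Q x) + (1 / 2 : ℝ) ^ n by
        have : (0 : ℝ) < (1 / 2) ^ n := by positivity
        linarith)
    refine ⟨⟨y, hy.1⟩, hy, fun z hz => ?_⟩
    have := csInf_le hbd ⟨z, hz, rfl⟩
    linarith
  choose nx hnx1 hnx2 using step
  obtain ⟨u, hu0, hu⟩ : ∃ u : ℕ → S, u 0 = ⟨x0, hx0⟩ ∧ ∀ n, u (n + 1) = nx n (u n) :=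
    ⟨fun n => Nat.rec ⟨x0, hx0⟩ (fun n x => nx n x) n, rfl, fun n => rfl⟩
  have hmem : ∀ n k : ℕ, (u (n + k)).1 ∈ Q (u n).1 := by
    intro n k
    induction k with
    | zero => exact ⟨(u n).2, by simp⟩
    | succ k ih =>
      have := hnx1 (n + k) (u (n + k))
      rw [← hu] at this
      exact hQt _ _ _ ih this
  have hanti : Antitone (fun n => f (u n)) := by
    apply antitone_nat_of_succ_le
    intro n
    have := (hmem n 1).2
    have h2 : 0 ≤ σ * dist (u n : α) (u (n + 1)) := by positivity
    linarith
  have hbdd : BddBelow (range fun n => f (u n)) := ⟨m, by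
    rintro _ ⟨n, rfl⟩
    exact hm _ (u n).2⟩
  have hlimf := tendsto_atTop_ciInf hanti hbdd
  set L := ⨅ n, f (u n) with hL
  have hLle : ∀ n, L ≤ f (u n) := fun n => ciInf_le hbdd n
  have hcau : CauchySeq (fun n => (u n : α)) := by
    refine cauchySeq_of_le_tendsto_0 (fun n => 2 * (f (u n) - L) / σ) ?_ ?_
    · intro n k N hn hk
      obtain ⟨a, rfl⟩ := Nat.exists_eq_add_of_le hn
      obtain ⟨b, rfl⟩ := Nat.exists_eq_add_of_le hk
      have h1 := (hmem N a).2
      have h2 := (hmem N b).2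
      have h3 := dist_triangle_left (u (N + a) : α) (u (N + b)) (u N)
      rw [le_div_iff₀ hσ]
      have h4 := hLle (N + a)
      have h5 := hLle (N + b)
      nlinarith
    · have : Tendsto (fun n => 2 * (f (u n) - L) / σ) atTop (𝓝 (2 * (L - L) / σ)) :=
        ((hlimf.sub_const L).const_mul 2).div_const σ
      simpa using this
  obtain ⟨x, hx⟩ := cauchySeq_tendsto_of_complete hcau
  have hQcl : ∀ y, IsClosed (Q y) := by
    intro y
    apply IsSeqClosed.isClosed
    intro z w hz hw
    have key : ∀ e > 0, w ∈ S ∧ f w ≤ f y - σ * dist y w + e := by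
      intro e he
      have h1 : Tendsto (fun n => f y - σ * dist y (z n)) atTop (𝓝 (f y - σ * dist y w)) :=
        tendsto_const_nhds.sub ((tendsto_const_nhds.dist hw).const_mul σ)
      have h2 := h1.eventually_lt_const (show f y - σ * dist y w < f y - σ * dist y w + e by linarith)
      have h3 : ∀ᶠ n in atTop, z n ∈ {x | x ∈ S ∧ f x ≤ f y - σ * dist y w + e} := by
        filter_upwards [h2] with n hn
        refine ⟨(hz n).1, ?_⟩
        have := (hz n).2
        linarith
      exact (hcl _).mem_of_tendsto hw h3
    refine ⟨(key 1 one_pos).1, ?_⟩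
    have : f w ≤ f y - σ * dist y w := le_of_forall_pos_le_add (fun e he => (key e he).2)
    linarith
  have hxQ : ∀ n, x ∈ Q (u n) := by
    intro n
    refine (hQcl _).mem_of_tendsto hx ?_
    filter_upwards [eventually_ge_atTop n] with k hk
    obtain ⟨a, rfl⟩ := Nat.exists_eq_add_of_le hk
    exact hmem n a
  refine ⟨x, (hxQ 0).1, ?_, ?_⟩
  · have := (hxQ 0).2
    have h0 : (u 0 : α) = x0 := by rw [hu0]
    rw [h0] at this
    linarith
  · intro y hy
    by_contra hcon
    push Not at hcon
    have hyx : y ∈ Q x := ⟨hy, by linarith⟩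
    have h1 : ∀ n, f x ≤ f y + (1 / 2 : ℝ) ^ n := by
      intro n
      have h2 := hnx2 n (u n) y (hQt _ _ _ (hxQ n) hyx)
      rw [← hu] at h2
      have h3 := (hxQ (n + 1)).2
      have : 0 ≤ σ * dist (u (n + 1) : α) x := by positivity
      linarith
    have h4 : Tendsto (fun n : ℕ => f y + (1 / 2 : ℝ) ^ n) atTop (𝓝 (f y + 0)) :=
      (tendsto_pow_atTop_nhds_zero_of_lt_one (by norm_num) (by norm_num)).const_add _
    have h5 := ge_of_tendsto' h4 h1
    have : 0 ≤ σ * dist x y := by positivity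
    linarith


lemma tApp {ι : Type*} {l : Filter ι} {f : ι → X →L[ℝ] ℝ} {g : ι → X} {f0 : X →L[ℝ] ℝ} {g0 : X}
    (hf : Tendsto f l (𝓝 f0)) (hg : Tendsto g l (𝓝 g0)) :
    Tendsto (fun i => f i (g i)) l (𝓝 (f0 g0)) :=
  ((isBoundedBilinearMap_apply (𝕜 := ℝ) (E := X) (F := ℝ)).continuous.tendsto (f0, g0)).comp
    (hf.prodMk_nhds hg)

structure Setup (Dm : Set X) (ψ Φ : X → ℝ) : Prop where
  zero_mem : (0 : X) ∈ Dm
  psi0 : ψ 0 = 0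
  nn : ∀ u, 0 ≤ ψ u
  conv : ∀ u ∈ Dm, ∀ v ∈ Dm, ∀ a b : ℝ, 0 ≤ a → 0 ≤ b → a + b = 1 →
    a • u + b • v ∈ Dm ∧ ψ (a • u + b • v) ≤ a * ψ u + b * ψ v
  closed : ∀ a, IsClosed {u | u ∈ Dm ∧ ψ u ≤ a}
  coer : ∀ C, ∃ R, ∀ u ∈ Dm, ψ u ≤ C → ‖u‖ ≤ R
  h3 : ∀ (u : ℕ → X) (w : X), (∀ j, u j ∈ Dm) → w ∈ Dm →
    (∀ f : X →L[ℝ] ℝ, Tendsto (fun j => f (u j)) atTop (𝓝 (f w))) →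
    Tendsto (fun j => ψ (u j)) atTop (𝓝 (ψ w)) → Tendsto u atTop (𝓝 w)
  diff : ContDiff ℝ 1 Φ
  h2 : ∀ u : ℕ → X, IsBounded (range u) → ∃ (φ : ℕ → ℕ) (w : X), StrictMono φ ∧
    (∀ f : X →L[ℝ] ℝ, Tendsto (fun j => f (u (φ j))) atTop (𝓝 (f w))) ∧
    ∀ v : X, ∀ r < fderiv ℝ Φ w (v - w), ∀ᶠ j in atTop, r < fderiv ℝ Φ (u (φ j)) (v - u (φ j))
  psiE : ∀ u, ψ (-u) = ψ u
  DmE : ∀ u ∈ Dm, -u ∈ Dm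
  phiE : ∀ u, Φ (-u) = Φ u

def Crit (Dm : Set X) (ψ Φ : X → ℝ) (lam : ℝ) (u : X) : Prop :=
  u ∈ Dm ∧ ∀ v ∈ Dm, fderiv ℝ Φ u (v - u) ≤ lam * (ψ v - ψ u)

def DD (ψ Φ : X → ℝ) (lam : ℝ) (w v : X) : ℝ := lam * (ψ v - ψ w) - fderiv ℝ Φ w (v - w)

namespace Setup
variable {Dm : Set X} {ψ Φ : X → ℝ}

lemma subConvex (hS : Setup Dm ψ Φ) (a : ℝ) : Convex ℝ {u | u ∈ Dm ∧ ψ u ≤ a} := by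
  intro u hu v hv s t hs ht hst
  obtain ⟨h1, h2⟩ := hS.conv u hu.1 v hv.1 s t hs ht hst
  refine ⟨h1, h2.trans ?_⟩
  have := hu.2
  have := hv.2
  have e : a = s * a + t * a := by rw [← add_mul, hst, one_mul]
  rw [e]
  gcongr

lemma wlsc (hS : Setup Dm ψ Φ) (u : ℕ → X) (w : X) (a : ℝ)
    (hu : ∀ᶠ j in atTop, u j ∈ Dm ∧ ψ (u j) ≤ a)
    (hw : ∀ f : X →L[ℝ] ℝ, Tendsto (fun j => f (u j)) atTop (𝓝 (f w))) : w ∈ Dm ∧ ψ w ≤ a := by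
  by_contra hcon
  obtain ⟨f, r, h1, h2⟩ := geometric_hahn_banach_closed_point (hS.subConvex a) (hS.closed a) hcon
  have : f w ≤ r := le_of_tendsto (hw f) (by
    filter_upwards [hu] with j hj
    exact (h1 _ hj).le)
  linarith

lemma psiBound (hS : Setup Dm ψ Φ) (u : ℕ → X) (w : X) (hu : ∀ j, u j ∈ Dm)
    (hw : ∀ f : X →L[ℝ] ℝ, Tendsto (fun j => f (u j)) atTop (𝓝 (f w)))
    (h : ∀ e > 0, ∀ᶠ j in atTop, ψ (u j) ≤ ψ w + e) : Tendsto (fun j => ψ (u j)) atTop (𝓝 (ψ w)) := by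
  rw [Metric.tendsto_nhds]
  intro e he
  have h1 : ∀ᶠ j in atTop, ψ w - e < ψ (u j) := by
    by_contra hcon
    rw [not_eventually] at hcon
    obtain ⟨φ, hφ, hφ2⟩ := extraction_of_frequently_atTop hcon
    have := hS.wlsc (u ∘ φ) w (ψ w - e) (Eventually.of_forall fun j => ⟨hu _, not_lt.1 (hφ2 j)⟩)
      (fun f => (hw f).comp hφ.tendsto_atTop)
    linarith [this.2]
  filter_upwards [h1, h (e / 2) (by linarith)] with j h1 h2
  rw [Real.dist_eq, abs_lt]
  constructor <;> linarith

lemma fderivCont (hS : Setup Dm ψ Φ) : Continuous (fun u => fderiv ℝ Φ u) :=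
  hS.diff.continuous_fderiv (by norm_num)

lemma hasF (hS : Setup Dm ψ Φ) (u : X) : HasFDerivAt Φ (fderiv ℝ Φ u) u :=
  (hS.diff.differentiable (by norm_num) u).hasFDerivAt

lemma lim (hS : Setup Dm ψ Φ) (l : ℕ → ℝ) (lam : ℝ) (hlam : 0 < lam) (hl : Tendsto l atTop (𝓝 lam))
    (w : ℕ → X) (hw : ∀ n, w n ∈ Dm) (hb : IsBounded (range w)) (e : ℕ → ℝ)
    (he : Tendsto e atTop (𝓝 0))
    (hD : ∀ n, ∀ v ∈ Dm, -(e n * (1 + ‖v - w n‖ + ψ v)) ≤ DD ψ Φ (l n) (w n) v) :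
    ∃ (φ : ℕ → ℕ) (w0 : X), StrictMono φ ∧ Tendsto (fun n => w (φ n)) atTop (𝓝 w0) ∧
      Tendsto (fun n => ψ (w (φ n))) atTop (𝓝 (ψ w0)) ∧ Crit Dm ψ Φ lam w0 := by
  obtain ⟨φ, w0, hφ, hweak, hlow⟩ := hS.h2 w hb
  obtain ⟨C, hC⟩ := hb.exists_norm_le
  have hC' : ∀ n, ‖w n‖ ≤ C := fun n => hC _ ⟨n, rfl⟩
  have hl' := hl.comp hφ.tendsto_atTop
  have he' := he.comp hφ.tendsto_atTop
  -- generic upper bound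
  have gen : ∀ v ∈ Dm, ∀ r, - fderiv ℝ Φ w0 (v - w0) < r → ∀ᶠ n in atTop,
      l (φ n) * ψ (w (φ n)) ≤ l (φ n) * ψ v + r := by
    intro v hv r hr
    have h1 := hlow v (-((- fderiv ℝ Φ w0 (v - w0) + r) / 2)) (by linarith)
    have h2 : Tendsto (fun n => |e (φ n)| * (1 + (‖v‖ + C) + ψ v)) atTop (𝓝 (|0| * (1 + (‖v‖ + C) + ψ v))) :=
      (he'.abs).mul_const _
    rw [abs_zero, zero_mul] at h2
    have h3 := h2.eventually_lt_const (show 0 < (r + fderiv ℝ Φ w0 (v - w0)) / 2 by linarith)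
    filter_upwards [h1, h3] with n h1 h3
    have h4 := hD (φ n) v hv
    unfold DD at h4
    have h5 : ‖v - w (φ n)‖ ≤ ‖v‖ + C := (norm_sub_le _ _).trans (by linarith [hC' (φ n)])
    have h6 : e (φ n) * (1 + ‖v - w (φ n)‖ + ψ v) ≤ |e (φ n)| * (1 + (‖v‖ + C) + ψ v) := by
      have := hS.nn v
      have a1 : 0 ≤ 1 + ‖v - w (φ n)‖ + ψ v := by positivity
      calc _ ≤ |e (φ n)| * (1 + ‖v - w (φ n)‖ + ψ v) :=
            mul_le_mul_of_nonneg_right (le_abs_self _) a1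
        _ ≤ _ := by gcongr
    linarith
  have hlpos : ∀ᶠ n in atTop, lam / 2 < l (φ n) := hl'.eventually_const_lt (by linarith)
  have hw0 : w0 ∈ Dm := by
    have h1 := gen 0 hS.zero_mem (|fderiv ℝ Φ w0 (0 - w0)| + 1)
      (by linarith [neg_le_abs (fderiv ℝ Φ w0 (0 - w0))])
    set r := |fderiv ℝ Φ w0 (0 - w0)| + 1
    refine (hS.wlsc (fun n => w (φ n)) w0 (r / (lam / 2)) ?_ hweak).1
    filter_upwards [h1, hlpos] with n h1 h2
    refine ⟨hw _, ?_⟩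
    rw [le_div_iff₀ (by linarith)]
    rw [hS.psi0] at h1
    have := hS.nn (w (φ n))
    nlinarith
  have hψ : Tendsto (fun n => ψ (w (φ n))) atTop (𝓝 (ψ w0)) := by
    refine hS.psiBound _ w0 (fun n => hw _) hweak ?_
    intro ε hε
    have h1 := gen w0 hw0 (lam / 2 * ε) (by simp; positivity)
    filter_upwards [h1, hlpos] with n h1 h2
    have h3 : l (φ n) * ψ (w (φ n)) ≤ l (φ n) * (ψ w0 + ε) := by nlinarith
    exact le_of_mul_le_mul_left h3 (by linarith)
  have hst : Tendsto (fun n => w (φ n)) atTop (𝓝 w0) := hS.h3 _ w0 (fun n => hw _) hw0 hweak hψ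
  refine ⟨φ, w0, hφ, hst, hψ, hw0, ?_⟩
  intro v hv
  have t1 : Tendsto (fun n => fderiv ℝ Φ (w (φ n)) (v - w (φ n))) atTop
      (𝓝 (fderiv ℝ Φ w0 (v - w0))) :=
    tApp ((hS.fderivCont.tendsto w0).comp hst) (tendsto_const_nhds.sub hst)
  have t2 : Tendsto (fun n => DD ψ Φ (l (φ n)) (w (φ n)) v) atTop (𝓝 (DD ψ Φ lam w0 v)) :=
    (hl'.mul (tendsto_const_nhds.sub hψ)).sub t1
  have t3 : Tendsto (fun n => -(e (φ n) * (1 + ‖v - w (φ n)‖ + ψ v))) atTop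
      (𝓝 (-(0 * (1 + ‖v - w0‖ + ψ v)))) :=
    (he'.mul (((tendsto_const_nhds.sub hst).norm.const_add 1).add_const _)).neg
  have := le_of_tendsto_of_tendsto' t3 t2 (fun n => hD (φ n) v hv)
  unfold DD at this
  linarith

lemma ps (hS : Setup Dm ψ Φ) (lam : ℝ) (hlam : 0 < lam) (c A : ℝ) (F : Set X) (hF : IsClosed F)
    (hno : ∀ u ∈ F, Crit Dm ψ Φ lam u → lam * ψ u - Φ u = c → ψ u ≤ A → False) :
    ∃ δ > 0, ∃ η > 0, ∀ w ∈ Dm, w ∈ F → ψ w ≤ A → |lam * ψ w - Φ w - c| ≤ η →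
      ∃ v ∈ Dm, ‖v - w‖ ≤ 1 ∧ ψ v ≤ A + 1 ∧ DD ψ Φ lam w v < -δ := by
  by_contra hcon
  push Not at hcon
  have hpos : ∀ n : ℕ, (0 : ℝ) < 1 / ((n : ℝ) + 1) := fun n => by positivity
  choose w hwD hwF hwA hwc hv using fun n : ℕ => hcon _ (hpos n) _ (hpos n)
  obtain ⟨R, hR⟩ := hS.coer A
  have h0 : Tendsto (fun n : ℕ => (1 : ℝ) / ((n : ℝ) + 1)) atTop (𝓝 0) :=
      tendsto_one_div_add_atTop_nhds_zero_nat
  obtain ⟨φ, w0, hφ, hst, hψ, hcr⟩ := hS.lim (fun _ => lam) lam hlam tendsto_const_nhds w hwD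
    ((isBounded_iff_forall_norm_le).2 ⟨R, by
      rintro _ ⟨n, rfl⟩
      exact hR _ (hwD n) (hwA n)⟩) (fun n : ℕ => (1 : ℝ) / ((n : ℝ) + 1)) h0 (by
    intro n v hvD
    have hp : 0 < 1 + ‖v - w n‖ + ψ v := by
      have := hS.nn v
      positivity
    set q := 1 + ‖v - w n‖ + ψ v with hq
    have hpn := hS.nn v
    have hnn := norm_nonneg (v - w n)
    set t := 1 / q with ht
    have ht0 : 0 < t := by positivity
    have ht1 : t ≤ 1 := by
      rw [ht, div_le_one hp]
      linarith
    obtain ⟨h1, h2⟩ := hS.conv (w n) (hwD n) v hvD (1 - t) t (by linarith) ht0.le (by ring)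
    have e1 : (1 - t) • w n + t • v - w n = t • (v - w n) := by module
    have htq : t * q = 1 := by rw [ht]; field_simp
    have h3 := hv n _ h1 (by
      rw [e1, norm_smul, Real.norm_eq_abs, abs_of_pos ht0]
      nlinarith) (by
      have := hwA n
      have := hS.nn (w n)
      nlinarith)
    unfold DD at h3
    rw [e1, map_smul, smul_eq_mul] at h3
    have h4 : -(1 / ((n : ℝ) + 1)) ≤ t * DD ψ Φ lam (w n) v := by
      unfold DD
      nlinarith
    calc -(1 / ((n : ℝ) + 1) * q) = -(1 / ((n : ℝ) + 1)) * q := by ring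
      _ ≤ (t * DD ψ Φ lam (w n) v) * q := by gcongr
      _ = (t * q) * DD ψ Φ lam (w n) v := by ring
      _ = _ := by rw [htq, one_mul])
  refine hno w0 (hF.mem_of_tendsto hst (Eventually.of_forall fun n => hwF _)) hcr ?_ ?_
  · have t1 : Tendsto (fun n => |lam * ψ (w (φ n)) - Φ (w (φ n)) - c|) atTop
        (𝓝 |lam * ψ w0 - Φ w0 - c|) :=
      (((hψ.const_mul lam).sub ((hS.diff.continuous.tendsto w0).comp hst)).sub_const c).abs
    have t2 := le_of_tendsto_of_tendsto' t1 (h0.comp hφ.tendsto_atTop) (fun n => hwc (φ n))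
    have := abs_nonpos_iff.1 t2
    linarith
  · exact le_of_tendsto' hψ (fun n => hwA _)

end Setup
end SMPAn
namespace SMPAn

def ii (ψ Φ : X → ℝ) (lam : ℝ) (u : X) : ℝ := lam * ψ u - Φ u

namespace Setup
variable {Dm : Set X} {ψ Φ : X → ℝ}

lemma lscPsi (hS : Setup Dm ψ Φ) (u0 : X) (h0 : u0 ∈ Dm) (e : ℝ) (he : 0 < e) :
    ∀ᶠ u in 𝓝 u0, u ∈ Dm → ψ u0 - e < ψ u := by
  have h1 : u0 ∈ {u | u ∈ Dm ∧ ψ u ≤ ψ u0 - e}ᶜ := by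
    rintro ⟨_, h⟩
    linarith
  filter_upwards [(hS.closed (ψ u0 - e)).isOpen_compl.mem_nhds h1] with u hu hD
  by_contra hcon
  exact hu ⟨hD, not_lt.1 hcon⟩

lemma closedI (hS : Setup Dm ψ Φ) (lam : ℝ) (hl : 0 < lam) (a : ℝ) :
    IsClosed {u | u ∈ Dm ∧ ii ψ Φ lam u ≤ a} := by
  apply IsSeqClosed.isClosed
  intro z w hz hw
  have hΦ : Tendsto (fun n => Φ (z n)) atTop (𝓝 (Φ w)) := (hS.diff.continuous.tendsto w).comp hw
  have key : ∀ e > 0, w ∈ Dm ∧ ψ w ≤ (a + Φ w) / lam + e := by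
    intro e he
    have h1 : Tendsto (fun n => (a + Φ (z n)) / lam) atTop (𝓝 ((a + Φ w) / lam)) :=
      (hΦ.const_add a).div_const lam
    have h2 := h1.eventually_lt_const (show (a + Φ w) / lam < (a + Φ w) / lam + e by linarith)
    refine (hS.closed ((a + Φ w) / lam + e)).mem_of_tendsto hw ?_
    filter_upwards [h2] with n hn
    refine ⟨(hz n).1, ?_⟩
    have h3 := (hz n).2
    unfold ii at h3
    have : ψ (z n) ≤ (a + Φ (z n)) / lam := by
      rw [le_div_iff₀ hl]; linarith
    linarith
  refine ⟨(key 1 one_pos).1, ?_⟩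
  have h4 : ψ w ≤ (a + Φ w) / lam := le_of_forall_pos_le_add (fun e he => (key e he).2)
  rw [le_div_iff₀ hl] at h4
  unfold ii
  linarith

lemma convDD (hS : Setup Dm ψ Φ) (lam : ℝ) (hl : 0 ≤ lam) (w p q : X) (hp : p ∈ Dm) (hq : q ∈ Dm)
    (s t : ℝ) (hs : 0 ≤ s) (ht : 0 ≤ t) (hst : s + t = 1) :
    DD ψ Φ lam w (s • p + t • q) ≤ s * DD ψ Φ lam w p + t * DD ψ Φ lam w q := by
  have h1 := (hS.conv p hp q hq s t hs ht hst).2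
  have e1 : s • p + t • q - w = s • (p - w) + t • (q - w) := by
    have : w = (s + t) • w := by rw [hst, one_smul]
    nth_rewrite 1 [this]
    module
  unfold DD
  rw [e1, map_add, map_smul, map_smul, smul_eq_mul, smul_eq_mul]
  have h2 : lam * ψ (s • p + t • q) ≤ lam * (s * ψ p + t * ψ q) := by gcongr
  have h3 : lam * ψ w = lam * (s * ψ w + t * ψ w) := by rw [← add_mul, hst, one_mul]
  linarith

lemma phiErr (hS : Setup Dm ψ Φ) (C : Set X) (hC : IsCompact C) (ω : ℝ) (hω : 0 < ω) :
    ∃ r > 0, ∀ x ∈ C, ∀ y, ‖y - x‖ < r → |Φ y - Φ x - fderiv ℝ Φ x (y - x)| ≤ ω * ‖y - x‖ := by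
  have h1 := hC.uniformContinuousAt_of_continuousAt (fderiv ℝ Φ)
    (fun a _ => hS.fderivCont.continuousAt) (Metric.dist_mem_uniformity hω)
  obtain ⟨r, hr, h2⟩ := Metric.mem_uniformity_dist.1 h1
  refine ⟨r, hr, fun x hx y hy => ?_⟩
  have h3 := (convex_ball x r).norm_image_sub_le_of_norm_hasFDerivWithin_le' (f := Φ)
    (f' := fun z => fderiv ℝ Φ z) (φ := fderiv ℝ Φ x) (C := ω) (x := x) (y := y)
    (fun z _ => (hS.hasF z).hasFDerivWithinAt)
    (fun z hz => by
      have := h2 (a := x) (b := z) (by rwa [dist_comm]) hx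
      simp only [mem_ofPred_eq] at this
      rw [dist_comm, dist_eq_norm] at this
      exact this.le)
    (mem_ball_self hr) (by rwa [mem_ball, dist_eq_norm])
  rwa [Real.norm_eq_abs] at h3

lemma step (hS : Setup Dm ψ Φ) (lam : ℝ) (hl : 0 ≤ lam) (u p : X) (hu : u ∈ Dm) (hp : p ∈ Dm)
    (t ω : ℝ) (ht : 0 ≤ t) (ht1 : t ≤ 1)
    (herr : |Φ (u + t • (p - u)) - Φ u - fderiv ℝ Φ u (t • (p - u))| ≤ ω * ‖t • (p - u)‖) :
    u + t • (p - u) ∈ Dm ∧ ii ψ Φ lam (u + t • (p - u)) ≤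
      ii ψ Φ lam u + t * (DD ψ Φ lam u p + ω * ‖p - u‖) := by
  have e : u + t • (p - u) = (1 - t) • u + t • p := by module
  obtain ⟨h1, h2⟩ := hS.conv u hu p hp (1 - t) t (by linarith) ht (by ring)
  rw [← e] at h1 h2
  refine ⟨h1, ?_⟩
  rw [norm_smul, Real.norm_eq_abs, abs_of_nonneg ht, map_smul, smul_eq_mul, abs_le] at herr
  unfold ii DD
  have h3 : lam * ψ (u + t • (p - u)) ≤ lam * ((1 - t) * ψ u + t * ψ p) := by gcongr
  linarith [herr.1]

end Setup

section core
variable {Dm : Set X} {ψ Φ : X → ℝ} {K : Type*} [TopologicalSpace K]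

def tset (Dm : Set X) (ψ Φ : X → ℝ) (lam lam' R a b δ : ℝ) (bd Z : Set K) (γ : K → X) (ζ : K) :
    Set X :=
  {p | (ζ ∈ bd → p = γ ζ) ∧ ‖p - γ ζ‖ ≤ 2 ∧ (ζ ∈ Z → p ∈ Dm ∧ ψ p ≤ R ∧
    (a < ii ψ Φ lam (γ ζ) → DD ψ Φ lam (γ ζ) p ≤ -δ) ∧
    (b < ii ψ Φ lam' (γ ζ) → DD ψ Φ lam' (γ ζ) p + δ * ‖p - γ ζ‖ ≤ 0))}

lemma tset_convex (hS : Setup Dm ψ Φ) {lam lam' R a b δ : ℝ} (hl : 0 ≤ lam) (hl' : 0 ≤ lam')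
    (hδ : 0 ≤ δ) (bd Z : Set K) (γ : K → X) (ζ : K) :
    Convex ℝ (tset Dm ψ Φ lam lam' R a b δ bd Z γ ζ) := by
  rintro p ⟨p1, p2, p3⟩ q ⟨q1, q2, q3⟩ s t hs ht hst
  have e1 : s • p + t • q - γ ζ = s • (p - γ ζ) + t • (q - γ ζ) := by
    have : γ ζ = (s + t) • γ ζ := by rw [hst, one_smul]
    nth_rewrite 1 [this]
    module
  have n1 : ‖s • p + t • q - γ ζ‖ ≤ s * ‖p - γ ζ‖ + t * ‖q - γ ζ‖ := by
    rw [e1]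
    refine (norm_add_le _ _).trans ?_
    rw [norm_smul, norm_smul, Real.norm_eq_abs, Real.norm_eq_abs, abs_of_nonneg hs, abs_of_nonneg ht]
  refine ⟨fun h => ?_, ?_, fun hZ => ?_⟩
  · rw [p1 h, q1 h, ← add_smul, hst, one_smul]
  · refine n1.trans ?_
    calc s * ‖p - γ ζ‖ + t * ‖q - γ ζ‖ ≤ s * 2 + t * 2 := by gcongr
      _ = 2 := by rw [← add_mul, hst, one_mul]
  · obtain ⟨p3, p4, p5, p6⟩ := p3 hZ
    obtain ⟨q3, q4, q5, q6⟩ := q3 hZ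
    obtain ⟨h1, h2⟩ := hS.conv p p3 q q3 s t hs ht hst
    refine ⟨h1, (hS.subConvex R ⟨p3, p4⟩ ⟨q3, q4⟩ hs ht hst).2, fun h => ?_, fun h => ?_⟩
    · refine (hS.convDD lam hl _ p q p3 q3 s t hs ht hst).trans ?_
      calc _ ≤ s * (-δ) + t * (-δ) := by
            gcongr
            exacts [p5 h, q5 h]
        _ = -δ := by rw [← add_mul, hst, one_mul]
    · have h3 := hS.convDD lam' hl' (γ ζ) p q p3 q3 s t hs ht hst
      have h4 := mul_le_mul_of_nonneg_left n1 hδ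
      have h5 := mul_nonpos_of_nonneg_of_nonpos hs (p6 h)
      have h6 := mul_nonpos_of_nonneg_of_nonpos ht (q6 h)
      nlinarith

/-- Uniform constants used in the deformation lemma. -/
structure Consts (lam lam' c M δ dl1 η R a b lmax : ℝ) : Prop where
  lam_pos : 0 < lam
  lt : lam < lam'
  lmax : lam' ≤ lmax
  c_pos : 0 < c
  M_nn : 0 ≤ M
  δ_pos : 0 < δ
  dl1_pos : 0 < dl1
  η_pos : 0 < η
  ηc : η ≤ c
  dl1a : dl1 ≤ δ / 8
  dl1b : dl1 ≤ η / 8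
  dl1c : dl1 ≤ c / 8
  l1 : (M + 3) * (lam' - lam) ≤ δ / 4
  l2 : (M + 3) * (lam' - lam) ≤ η / 4
  l3 : lam' - lam ≤ c / 2
  ha : c - (lam' - lam) ≤ a
  hb : b = c + (M + 1) * (lam' - lam) - η / 4
  hR : M + 3 ≤ R

lemma core_sel (hS : Setup Dm ψ Φ) [CompactSpace K] [T2Space K]
    {lam lam' c M δ dl1 η R a b lmax : ℝ} (hc : Consts lam lam' c M δ dl1 η R a b lmax)
    (bd Z O : Set K) (hbd : IsClosed bd) (hZ : IsClosed Z) (hO : IsOpen O) (hbO : bd ⊆ O)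
    (P : K → X) (hP : ContinuousOn P O) (hPD : ∀ ζ ∈ O, P ζ ∈ Dm)
    (hPI : ∀ ζ ∈ O, ii ψ Φ lmax (P ζ) ≤ 0)
    (γ : K → X) (hγ : Continuous γ) (hγP : ∀ ζ ∈ bd, γ ζ = P ζ)
    (hγZ : ∀ ζ ∈ Z, γ ζ ∈ Dm ∧ ii ψ Φ lam' (γ ζ) ≤ c + (M + 1) * (lam' - lam))
    (hRγ : ∀ ζ ∈ Z, ψ (γ ζ) ≤ R) (hRP : ∀ ζ ∈ bd, Φ (γ ζ) + 1 ≤ lmax * R)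
    (hPS : ∀ ζ ∈ Z, ψ (γ ζ) ≤ M + 2 → |ii ψ Φ lam (γ ζ) - c| ≤ η →
      ∃ v ∈ Dm, ‖v - γ ζ‖ ≤ 1 ∧ ψ v ≤ M + 3 ∧ DD ψ Φ lam (γ ζ) v < -δ) :
    ∃ p : C(K, X), ∀ ζ, p ζ ∈ tset Dm ψ Φ lam lam' R a b dl1 bd Z γ ζ := by
  obtain ⟨lam_pos, hlt, hlmax, c_pos, M_nn, δ_pos, dl1_pos, η_pos, ηc, dl1a, dl1b, dl1c, l1, l2, l3,
    ha, hb, hR⟩ := hc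
  have hΦc := hS.diff.continuous
  set ℓ := lam' - lam with hℓ
  have hℓ0 : 0 < ℓ := by rw [hℓ]; linarith
  have hMℓ : 0 ≤ M * ℓ := by positivity
  have imono : ∀ u, ii ψ Φ lam' u = ii ψ Φ lam u + ℓ * ψ u := by
    intro u; unfold ii; rw [hℓ]; ring
  -- the bracket tends to zero
  have brk : ∀ (ζ0 : K) (q : K → X), ContinuousAt q ζ0 → q ζ0 = γ ζ0 → ∀ e > 0,
      ∀ᶠ ζ in 𝓝 ζ0, Φ (q ζ) - Φ (γ ζ) - fderiv ℝ Φ (γ ζ) (q ζ - γ ζ) < e := by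
    intro ζ0 q hq hq0 e he
    have t1 : Tendsto (fun ζ => Φ (q ζ) - Φ (γ ζ) - fderiv ℝ Φ (γ ζ) (q ζ - γ ζ)) (𝓝 ζ0)
        (𝓝 (Φ (q ζ0) - Φ (γ ζ0) - fderiv ℝ Φ (γ ζ0) (q ζ0 - γ ζ0))) :=
      ((hΦc.continuousAt.tendsto.comp hq.tendsto).sub
        (hΦc.continuousAt.tendsto.comp hγ.continuousAt.tendsto)).sub
        (tApp (hS.fderivCont.continuousAt.tendsto.comp hγ.continuousAt.tendsto)
          (hq.tendsto.sub hγ.continuousAt.tendsto))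
    rw [hq0] at t1
    simp only [sub_self, map_zero] at t1
    exact t1.eventually_lt_const he
  have DDe : ∀ (mu : ℝ) (u q : X), DD ψ Φ mu u q =
      ii ψ Φ mu q - ii ψ Φ mu u + (Φ q - Φ u - fderiv ℝ Φ u (q - u)) := by
    intro mu u q; unfold DD ii; ring
  have nrm : ∀ (ζ0 : K) (q : K → X), ContinuousAt q ζ0 → ‖q ζ0 - γ ζ0‖ ≤ 1 →
      ∀ᶠ ζ in 𝓝 ζ0, ‖q ζ - γ ζ‖ < 2 := by
    intro ζ0 q hq hq0
    have : Tendsto (fun ζ => ‖q ζ - γ ζ‖) (𝓝 ζ0) (𝓝 ‖q ζ0 - γ ζ0‖) :=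
      (hq.tendsto.sub hγ.continuousAt.tendsto).norm
    exact this.eventually_lt_const (by linarith)
  have dn : ∀ x : X, ‖x‖ < 2 → dl1 * ‖x‖ ≤ 2 * dl1 := fun x hx => by nlinarith
  let T : Set K := {ζ | ζ ∈ Z ∧ a < ii ψ Φ lam (γ ζ)}
  have hTψ : ∀ ζ ∈ T, ψ (γ ζ) ≤ M + 2 := by
    rintro ζ ⟨h1, h2⟩
    have h3 := (hγZ ζ h1).2
    rw [imono] at h3
    have : ℓ * ψ (γ ζ) ≤ ℓ * (M + 2) := by linarith
    exact le_of_mul_le_mul_left this hℓ0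
  have hTcl : ∀ ζ ∈ closure T, ζ ∈ Z ∧ ψ (γ ζ) ≤ M + 2 := by
    intro ζ hζ
    have h1 : closure T ⊆ Z := closure_minimal (fun ζ h => h.1) hZ
    have h2 : closure T ⊆ γ ⁻¹' {u | u ∈ Dm ∧ ψ u ≤ M + 2} :=
      closure_minimal (fun ζ h => ⟨(hγZ ζ h.1).1, hTψ ζ h⟩) ((hS.closed _).preimage hγ)
    exact ⟨h1 hζ, (h2 hζ).2⟩
  -- package: a local choice
  have pack : ∀ (ζ0 : K) (q : K → X) (V : Set K), V ∈ 𝓝 ζ0 → ContinuousOn q V →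
      (∀ᶠ ζ in 𝓝 ζ0, q ζ ∈ tset Dm ψ Φ lam lam' R a b dl1 bd Z γ ζ) →
      ∃ U ∈ 𝓝 ζ0, ∃ g : K → X, ContinuousOn g U ∧
        ∀ y ∈ U, g y ∈ tset Dm ψ Φ lam lam' R a b dl1 bd Z γ y := by
    intro ζ0 q V hV hq hev
    exact ⟨_, inter_mem hV hev, q, hq.mono inter_subset_left, fun y hy => hy.2⟩
  refine exists_continuous_forall_mem_convex_of_local
    (fun ζ => tset_convex hS lam_pos.le (by linarith) dl1_pos.le bd Z γ ζ) ?_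
  intro ζ0
  by_cases h0 : ζ0 ∈ bd
  · -- near the boundary
    have hON : O ∈ 𝓝 ζ0 := hO.mem_nhds (hbO h0)
    have hPc : ContinuousAt P ζ0 := hP.continuousAt hON
    have hΦP : ∀ᶠ ζ in 𝓝 ζ0, Φ (P ζ) < Φ (P ζ0) + 1 :=
      (hΦc.continuousAt.comp hPc).eventually_lt_const (show (Φ ∘ P) ζ0 < _ by simp)
    refine pack ζ0 P O hON hP ?_
    filter_upwards [hON, nrm ζ0 P hPc (by simp [hγP ζ0 h0]), hΦP,
      brk ζ0 P hPc (hγP ζ0 h0).symm (c / 8) (by linarith)] with ζ hζO hn hφ hbr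
    have hI := hPI ζ hζO
    have hnnP := hS.nn (P ζ)
    have hI1 : ii ψ Φ lam' (P ζ) ≤ 0 := by
      unfold ii at hI ⊢
      nlinarith
    have hI2 : ii ψ Φ lam (P ζ) ≤ 0 := by
      rw [imono] at hI1
      nlinarith
    refine ⟨fun h => (hγP ζ h).symm, hn.le, fun hz => ⟨hPD ζ hζO, ?_, fun h => ?_, fun h => ?_⟩⟩
    · have := hRP ζ0 h0
      rw [hγP ζ0 h0] at this
      unfold ii at hI
      have h3 : lmax * ψ (P ζ) ≤ lmax * R := by linarith
      exact le_of_mul_le_mul_left h3 (by linarith)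
    · rw [DDe]
      linarith
    · rw [DDe]
      have := dn _ hn
      rw [hb] at h
      linarith
  · have hbdN : bdᶜ ∈ 𝓝 ζ0 := hbd.isOpen_compl.mem_nhds h0
    by_cases hT : ζ0 ∈ closure T
    · obtain ⟨hz0, hψ0⟩ := hTcl ζ0 hT
      obtain ⟨hD0, hB0⟩ := hγZ ζ0 hz0
      by_cases hlow : c - η ≤ ii ψ Φ lam (γ ζ0)
      · -- use the Palais-Smale vector
        obtain ⟨v, hvD, hv1, hv2, hv3⟩ := hPS ζ0 hz0 hψ0 (by
          rw [abs_le]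
          rw [imono] at hB0
          have := mul_nonneg hℓ0.le (hS.nn (γ ζ0))
          constructor <;> linarith)
        have t1 : Tendsto (fun ζ => fderiv ℝ Φ (γ ζ) (v - γ ζ)) (𝓝 ζ0)
            (𝓝 (fderiv ℝ Φ (γ ζ0) (v - γ ζ0))) :=
          tApp (hS.fderivCont.continuousAt.tendsto.comp hγ.continuousAt.tendsto)
            (tendsto_const_nhds.sub hγ.continuousAt.tendsto)
        have t2 := t1.eventually_const_lt
          (show fderiv ℝ Φ (γ ζ0) (v - γ ζ0) - δ / 8 < _ by linarith)
        have t3 := hγ.continuousAt.tendsto.eventually (hS.lscPsi (γ ζ0) hD0 (δ / 8 / lam) (by positivity))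
        refine pack ζ0 (fun _ => v) univ univ_mem continuousOn_const ?_
        filter_upwards [hbdN, nrm ζ0 (fun _ => v) continuousAt_const hv1, t2, t3] with ζ hζb hn e2 e3
        have hDD : ζ ∈ Z → DD ψ Φ lam (γ ζ) v ≤ - δ + δ / 4 := by
          intro hz
          have h5 := e3 (hγZ ζ hz).1
          have h6 : lam * (ψ (γ ζ0) - δ / 8 / lam) ≤ lam * ψ (γ ζ) := by gcongr
          have h7 : lam * (ψ (γ ζ0) - δ / 8 / lam) = lam * ψ (γ ζ0) - δ / 8 := by field_simp
          unfold DD at hv3 ⊢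
          linarith
        refine ⟨fun h => absurd h hζb, hn.le, fun hz => ⟨hvD, by linarith, fun h => ?_, fun h => ?_⟩⟩
        · have := hDD hz
          linarith
        · have h1 := hDD hz
          have h2 : DD ψ Φ lam' (γ ζ) v = DD ψ Φ lam (γ ζ) v + ℓ * (ψ v - ψ (γ ζ)) := by
            unfold DD; rw [hℓ]; ring
          have h3 : ℓ * (ψ v - ψ (γ ζ)) ≤ (M + 3) * ℓ := by
            have := hS.nn (γ ζ)
            nlinarith
          have := dn _ hn
          linarith
      · -- low point in the closure
        push Not at hlow
        refine pack ζ0 (fun _ => γ ζ0) univ univ_mem continuousOn_const ?_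
        filter_upwards [hbdN, nrm ζ0 (fun _ => γ ζ0) continuousAt_const (by simp),
          brk ζ0 (fun _ => γ ζ0) continuousAt_const rfl (η / 8) (by linarith)] with ζ hζb hn hbr
        have hI0 : ii ψ Φ lam' (γ ζ0) ≤ c - η + (M + 2) * ℓ := by
          rw [imono]
          nlinarith
        refine ⟨fun h => absurd h hζb, hn.le, fun hz => ⟨hD0, by linarith, fun h => ?_, fun h => ?_⟩⟩
        · rw [DDe]
          linarith
        · rw [DDe]
          have := dn _ hn
          rw [hb] at h
          linarith
    · refine pack ζ0 γ univ univ_mem hγ.continuousOn ?_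
      filter_upwards [hbdN, isClosed_closure.isOpen_compl.mem_nhds hT] with ζ hζb hζT
      refine ⟨fun h => absurd h hζb, by simp, fun hz => ⟨(hγZ ζ hz).1, hRγ ζ hz, fun h => ?_, fun h => ?_⟩⟩
      · exact absurd (subset_closure (show ζ ∈ T from ⟨hz, h⟩)) hζT
      · simp [DD]

end core
end SMPAn
namespace SMPAn

section core
variable {Dm : Set X} {ψ Φ : X → ℝ}

lemma Setup.fderivNeg (hS : Setup Dm ψ Φ) (u : X) : fderiv ℝ Φ (-u) = - fderiv ℝ Φ u := by
  have h1 : HasFDerivAt (fun x => Φ (-x)) ((fderiv ℝ Φ (-u)).comp (-(ContinuousLinearMap.id ℝ X))) u :=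
    (hS.hasF (-u)).comp u (hasFDerivAt_id u).neg
  have h2 : (fun x => Φ (-x)) = Φ := funext hS.phiE
  rw [h2] at h1
  have h3 := h1.unique (hS.hasF u)
  rw [← h3]
  ext v
  simp

lemma Setup.iiNeg (hS : Setup Dm ψ Φ) (lam : ℝ) (u : X) : ii ψ Φ lam (-u) = ii ψ Φ lam u := by
  unfold ii
  rw [hS.psiE, hS.phiE]

lemma Setup.DDNeg (hS : Setup Dm ψ Φ) (lam : ℝ) (u v : X) :
    DD ψ Φ lam (-u) (-v) = DD ψ Φ lam u v := by
  unfold DD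
  rw [hS.psiE, hS.psiE, hS.fderivNeg]
  have : -v - -u = -(v - u) := by abel
  rw [this, map_neg]
  simp

lemma tset_neg (hS : Setup Dm ψ Φ) {K : Type*} [InvolutiveNeg K] {lam lam' R a b δ : ℝ}
    (bd Z : Set K) (hbd : ∀ ζ ∈ bd, -ζ ∈ bd) (hZ : ∀ ζ ∈ Z, -ζ ∈ Z)
    (γ : K → X) (hγ : ∀ ζ, γ (-ζ) = - γ ζ) (ζ : K) (p : X)
    (hp : p ∈ tset Dm ψ Φ lam lam' R a b δ bd Z γ (-ζ)) :
    -p ∈ tset Dm ψ Φ lam lam' R a b δ bd Z γ ζ := by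
  obtain ⟨h1, h2, h3⟩ := hp
  rw [hγ] at h1 h2 h3
  have hn : ‖-p - γ ζ‖ = ‖p - -γ ζ‖ := by
    rw [← norm_neg]; congr 1; abel
  refine ⟨fun h => ?_, ?_, fun h => ?_⟩
  · rw [h1 (hbd _ h), neg_neg]
  · rw [hn]; exact h2
  · obtain ⟨a1, a2, a3, a4⟩ := h3 (hZ _ h)
    have e : ∀ mu, DD ψ Φ mu (-γ ζ) p = DD ψ Φ mu (γ ζ) (-p) := by
      intro mu
      rw [← hS.DDNeg, neg_neg]
    rw [hS.iiNeg, e] at a3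
    rw [hS.iiNeg, e, ← hn] at a4
    exact ⟨hS.DmE _ a1, by rw [hS.psiE]; exact a2, a3, a4⟩

lemma core_step (hS : Setup Dm ψ Φ) {K : Type*} [TopologicalSpace K] [CompactSpace K] [T2Space K]
    [InvolutiveNeg K] [ContinuousNeg K]
    {lam lam' c M δ dl1 η R a b lmax : ℝ} (hc : Consts lam lam' c M δ dl1 η R a b lmax)
    (bd Z O : Set K) (hbd : IsClosed bd) (hbs : ∀ ζ ∈ bd, -ζ ∈ bd)
    (hZ : IsClosed Z) (hZs : ∀ ζ ∈ Z, -ζ ∈ Z) (hO : IsOpen O) (hbO : bd ⊆ O)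
    (P : K → X) (hP : ContinuousOn P O) (hPD : ∀ ζ ∈ O, P ζ ∈ Dm)
    (hPI : ∀ ζ ∈ O, ii ψ Φ lmax (P ζ) ≤ 0)
    (γ : C(K, X)) (hγo : ∀ ζ, γ (-ζ) = - γ ζ) (hγP : ∀ ζ ∈ bd, γ ζ = P ζ)
    (hγZ : ∀ ζ ∈ Z, γ ζ ∈ Dm ∧ ii ψ Φ lam' (γ ζ) ≤ c + (M + 1) * (lam' - lam))
    (hRγ : ∀ ζ ∈ Z, ψ (γ ζ) ≤ R) (hRP : ∀ ζ ∈ bd, Φ (γ ζ) + 1 ≤ lmax * R)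
    (hPS : ∀ ζ ∈ Z, ψ (γ ζ) ≤ M + 2 → |ii ψ Φ lam (γ ζ) - c| ≤ η →
      ∃ v ∈ Dm, ‖v - γ ζ‖ ≤ 1 ∧ ψ v ≤ M + 3 ∧ DD ψ Φ lam (γ ζ) v < -δ)
    (κ : ℝ) (hκ : 0 < κ) (hJ : ∀ ζ ∈ Z, ii ψ Φ lam (γ ζ) ≤ a + κ) :
    ∃ t > 0, ∃ γ' : C(K, X), (∀ ζ, γ' (-ζ) = - γ' ζ) ∧ (∀ ζ ∈ bd, γ' ζ = P ζ) ∧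
      (∀ ζ ∈ Z, γ' ζ ∈ Dm ∧ ii ψ Φ lam' (γ' ζ) ≤ c + (M + 1) * (lam' - lam) ∧
        ii ψ Φ lam (γ' ζ) ≤ a + κ - t * dl1 / 2) ∧ dist γ γ' ≤ 2 * t := by
  obtain ⟨p0, hp0⟩ := core_sel hS hc bd Z O hbd hZ hO hbO P hP hPD hPI γ γ.continuous hγP hγZ hRγ
    hRP hPS
  obtain ⟨lam_pos, hlt, hlmax, c_pos, M_nn, δ_pos, dl1_pos, η_pos, ηc, dl1a, dl1b, dl1c, l1, l2, l3,
    ha, hb, hR⟩ := hc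
  obtain ⟨p, hp, hpo⟩ : ∃ p : C(K, X), (∀ ζ, p ζ ∈ tset Dm ψ Φ lam lam' R a b dl1 bd Z γ ζ) ∧
      ∀ ζ, p (-ζ) = - p ζ := by
    refine ⟨⟨fun ζ => (1 / 2 : ℝ) • p0 ζ + (1 / 2 : ℝ) • (-p0 (-ζ)), by fun_prop⟩, ?_, ?_⟩
    · intro ζ
      exact tset_convex hS lam_pos.le (by linarith) dl1_pos.le bd Z γ ζ (hp0 ζ)
        (tset_neg hS bd Z hbs hZs γ hγo ζ _ (hp0 (-ζ))) (by norm_num) (by norm_num) (by norm_num)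
    · intro ζ
      simp only [ContinuousMap.coe_mk, neg_neg]
      module
  obtain ⟨G, hG⟩ := (isCompact_univ (X := K)).exists_bound_of_continuousOn
    (f := fun ζ => fderiv ℝ Φ (γ ζ)) (hS.fderivCont.comp γ.continuous).continuousOn
  have hG' : ∀ ζ, ‖fderiv ℝ Φ (γ ζ)‖ ≤ |G| := fun ζ => (hG ζ (mem_univ _)).trans (le_abs_self _)
  obtain ⟨r, hr, herr⟩ := hS.phiErr (range γ) (isCompact_range γ.continuous) (dl1 / 4) (by linarith)
  have hRnn : 0 ≤ R := by linarith
  have hCst : 0 < lam' * R + |G| * 2 + dl1 := by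
    have : 0 < lam' := by linarith
    positivity
  set Cst := lam' * R + |G| * 2 + dl1 with hCd
  obtain ⟨t, ht0, ht1, htr, hta, htb⟩ : ∃ t > 0, t ≤ 1 ∧ 2 * t < r ∧ t * Cst ≤ κ ∧ t * Cst ≤ η / 4 := by
    refine ⟨min 1 (min (r / 3) (min (κ / Cst) (η / 4 / Cst))), by positivity, min_le_left _ _, ?_, ?_, ?_⟩
    · have : min 1 (min (r / 3) (min (κ / Cst) (η / 4 / Cst))) ≤ r / 3 :=
        (min_le_right _ _).trans (min_le_left _ _)
      linarith
    · rw [← le_div_iff₀ hCst]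
      exact (min_le_right _ _).trans ((min_le_right _ _).trans (min_le_left _ _))
    · rw [← le_div_iff₀ hCst]
      exact (min_le_right _ _).trans ((min_le_right _ _).trans (min_le_right _ _))
  have hpn : ∀ ζ, ‖p ζ - γ ζ‖ ≤ 2 := fun ζ => (hp ζ).2.1
  have hE : ∀ ζ, |Φ (γ ζ + t • (p ζ - γ ζ)) - Φ (γ ζ) - fderiv ℝ Φ (γ ζ) (t • (p ζ - γ ζ))| ≤
      dl1 / 4 * ‖t • (p ζ - γ ζ)‖ := by
    intro ζ
    have := herr (γ ζ) ⟨ζ, rfl⟩ (γ ζ + t • (p ζ - γ ζ)) (by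
      rw [add_sub_cancel_left, norm_smul, Real.norm_eq_abs, abs_of_pos ht0]
      nlinarith [hpn ζ])
    rwa [add_sub_cancel_left] at this
  have hDDb : ∀ ζ ∈ Z, ∀ mu, 0 ≤ mu → mu ≤ lam' → DD ψ Φ mu (γ ζ) (p ζ) ≤ lam' * R + |G| * 2 := by
    intro ζ hz mu h0 h1
    obtain ⟨-, h3, -⟩ := (hp ζ).2.2 hz
    unfold DD
    have h4 : |fderiv ℝ Φ (γ ζ) (p ζ - γ ζ)| ≤ |G| * 2 := by
      refine ((fderiv ℝ Φ (γ ζ)).le_opNorm _).trans ?_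
      exact mul_le_mul (hG' ζ) (hpn ζ) (norm_nonneg _) (abs_nonneg _)
    have h5 := (abs_le.1 h4).1
    have h6 : mu * (ψ (p ζ) - ψ (γ ζ)) ≤ lam' * R := by
      have := hS.nn (γ ζ)
      have := hS.nn (p ζ)
      calc mu * (ψ (p ζ) - ψ (γ ζ)) ≤ mu * R := by gcongr; linarith
        _ ≤ lam' * R := by gcongr
    linarith
  refine ⟨t, ht0, ⟨fun ζ => γ ζ + t • (p ζ - γ ζ), by fun_prop⟩, ?_, ?_, ?_, ?_⟩
  · intro ζ
    simp only [ContinuousMap.coe_mk, hγo, hpo]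
    module
  · intro ζ hζ
    simp only [ContinuousMap.coe_mk, (hp ζ).1 hζ, sub_self, smul_zero, add_zero, hγP ζ hζ]
  · intro ζ hz
    obtain ⟨a1, a2, a3, a4⟩ := (hp ζ).2.2 hz
    obtain ⟨b1, b2⟩ := hγZ ζ hz
    have s1 := hS.step lam' (by linarith) (γ ζ) (p ζ) b1 a1 t (dl1 / 4) ht0.le ht1 (hE ζ)
    have s2 := hS.step lam lam_pos.le (γ ζ) (p ζ) b1 a1 t (dl1 / 4) ht0.le ht1 (hE ζ)
    have hn := hpn ζ
    have hn0 := norm_nonneg (p ζ - γ ζ)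
    have hwn : dl1 / 4 * ‖p ζ - γ ζ‖ ≤ dl1 / 2 := by nlinarith
    refine ⟨s1.1, ?_, ?_⟩
    · simp only [ContinuousMap.coe_mk]
      refine s1.2.trans ?_
      by_cases h : b < ii ψ Φ lam' (γ ζ)
      · have h4 := a4 h
        have : DD ψ Φ lam' (γ ζ) (p ζ) + dl1 / 4 * ‖p ζ - γ ζ‖ ≤ 0 := by nlinarith
        have := mul_nonpos_of_nonneg_of_nonpos ht0.le this
        linarith
      · push Not at h
        have h5 := hDDb ζ hz lam' (by linarith) le_rfl
        have : t * (DD ψ Φ lam' (γ ζ) (p ζ) + dl1 / 4 * ‖p ζ - γ ζ‖) ≤ t * Cst := by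
          gcongr
          linarith
        rw [hb] at h
        linarith
    · simp only [ContinuousMap.coe_mk]
      refine s2.2.trans ?_
      by_cases h : a < ii ψ Φ lam (γ ζ)
      · have h4 := a3 h
        have : t * (DD ψ Φ lam (γ ζ) (p ζ) + dl1 / 4 * ‖p ζ - γ ζ‖) ≤ t * (-dl1 + dl1 / 2) := by
          gcongr
        have := hJ ζ hz
        linarith
      · push Not at h
        have h5 := hDDb ζ hz lam lam_pos.le hlt.le
        have : t * (DD ψ Φ lam (γ ζ) (p ζ) + dl1 / 4 * ‖p ζ - γ ζ‖) ≤ t * (Cst - dl1 / 2) := by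
          gcongr
          linarith
        linarith
  · rw [ContinuousMap.dist_le (by positivity)]
    intro ζ
    simp only [ContinuousMap.coe_mk]
    rw [dist_eq_norm, sub_add_cancel_left, norm_neg, norm_smul, Real.norm_eq_abs, abs_of_pos ht0]
    nlinarith [hpn ζ]

/-- Deformation lemma. -/
lemma core [CompleteSpace X] (hS : Setup Dm ψ Φ) (lam c M s lmax : ℝ) (hlam : 0 < lam)
    (hlmax : lam < lmax) (hc : 0 < c) (hM : 0 ≤ M) (hs : 0 < s) (F : Set X) (hF : IsClosed F)
    (hno : ∀ u ∈ F, Crit Dm ψ Φ lam u → lam * ψ u - Φ u = c → ψ u ≤ M + 2 → False) :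
    ∃ Δ > 0, ∀ lam', lam < lam' → lam' < lam + Δ →
      ∀ (K : Type) [TopologicalSpace K] [CompactSpace K] [T2Space K]
        [InvolutiveNeg K] [ContinuousNeg K]
        (bd Z O : Set K) (_hbd : IsClosed bd) (_hbs : ∀ ζ ∈ bd, -ζ ∈ bd)
        (_hZ : IsClosed Z) (_hZs : ∀ ζ ∈ Z, -ζ ∈ Z) (_hO : IsOpen O) (_hbO : bd ⊆ O)
        (P : K → X) (_hP : ContinuousOn P O) (_hPD : ∀ ζ ∈ O, P ζ ∈ Dm)
        (_hPI : ∀ ζ ∈ O, ii ψ Φ lmax (P ζ) ≤ 0)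
        (γ0 : C(K, X)) (_h0o : ∀ ζ, γ0 (-ζ) = - γ0 ζ) (_h0P : ∀ ζ ∈ bd, γ0 ζ = P ζ)
        (_h0Z : ∀ ζ ∈ Z, γ0 ζ ∈ Dm ∧ ii ψ Φ lam' (γ0 ζ) ≤ c + (M + 1) * (lam' - lam))
        (_h0F : ∀ ζ ∈ Z, ∀ x, ‖x - γ0 ζ‖ ≤ s → x ∈ F)
        (_hmm : ∀ γ : C(K, X), (∀ ζ, γ (-ζ) = - γ ζ) → (∀ ζ ∈ bd, γ ζ = P ζ) →
          ∀ b, (∀ ζ ∈ Z, γ ζ ∈ Dm ∧ ii ψ Φ lam (γ ζ) ≤ b) → c - (lam' - lam) / 2 ≤ b), False := by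
  obtain ⟨δ, hδ, η0, hη0, hPS⟩ := hS.ps lam hlam c (M + 2) F hF hno
  obtain ⟨η, hη, hηa, hηc⟩ : ∃ η > 0, η ≤ η0 ∧ η ≤ c := ⟨min η0 c, by positivity, min_le_left _ _, min_le_right _ _⟩
  obtain ⟨dl1, hdl1, d1, d2, d3⟩ : ∃ dl1 > 0, dl1 ≤ δ / 8 ∧ dl1 ≤ η / 8 ∧ dl1 ≤ c / 8 :=
    ⟨min (δ / 8) (min (η / 8) (c / 8)), by positivity, min_le_left _ _,
      (min_le_right _ _).trans (min_le_left _ _), (min_le_right _ _).trans (min_le_right _ _)⟩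
  obtain ⟨q, hq, q1, q2, q3, q4⟩ : ∃ q > 0, q ≤ δ / 4 ∧ q ≤ η / 4 ∧ q ≤ c / 2 ∧ q ≤ dl1 / 8 * s :=
    ⟨min (min (δ / 4) (η / 4)) (min (c / 2) (dl1 / 8 * s)), by positivity,
      (min_le_left _ _).trans (min_le_left _ _), (min_le_left _ _).trans (min_le_right _ _),
      (min_le_right _ _).trans (min_le_left _ _), (min_le_right _ _).trans (min_le_right _ _)⟩
  refine ⟨min (lmax - lam) (q / (M + 3)), lt_min (by linarith) (by positivity), ?_⟩
  intro lam' h1 h2 K _ _ _ _ _ bd Z O hbd hbs hZ hZs hO hbO P hP hPD hPI γ0 h0o h0P h0Z h0F hmm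
  have h3 : lam' - lam < lmax - lam := by
    have := min_le_left (lmax - lam) (q / (M + 3)); linarith
  have h4 : lam' - lam ≤ q / (M + 3) := by
    have := min_le_right (lmax - lam) (q / (M + 3)); linarith
  rw [le_div_iff₀ (by linarith)] at h4
  set ℓ := lam' - lam with hℓ
  have hℓ0 : 0 < ℓ := by rw [hℓ]; linarith
  have hMℓ : 0 ≤ M * ℓ := by positivity
  have hZne : Z.Nonempty := by
    by_contra hcon
    rw [not_nonempty_iff_eq_empty] at hcon
    have := hmm γ0 h0o h0P (c - ℓ) (by simp [hcon])
    linarith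
  set B := c + (M + 1) * ℓ with hB
  let S : Set C(K, X) := {γ | (∀ ζ, γ (-ζ) = - γ ζ) ∧ (∀ ζ ∈ bd, γ ζ = P ζ) ∧
    ∀ ζ ∈ Z, γ ζ ∈ Dm ∧ ii ψ Φ lam' (γ ζ) ≤ B}
  let J : C(K, X) → ℝ := fun γ => sSup ((fun ζ => ii ψ Φ lam (γ ζ)) '' Z)
  have hSb : ∀ γ ∈ S, BddAbove ((fun ζ => ii ψ Φ lam (γ ζ)) '' Z) := by
    rintro γ ⟨-, -, h⟩
    refine ⟨B, ?_⟩
    rintro _ ⟨ζ, hζ, rfl⟩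
    have h5 := (h ζ hζ).2
    have := hS.nn (γ ζ)
    unfold ii at h5 ⊢
    nlinarith
  have hJle : ∀ γ ∈ S, ∀ ζ ∈ Z, ii ψ Φ lam (γ ζ) ≤ J γ := fun γ hγ ζ hζ =>
    le_csSup (hSb γ hγ) ⟨ζ, hζ, rfl⟩
  have hJlow : ∀ γ ∈ S, c - ℓ / 2 ≤ J γ := fun γ hγ =>
    hmm γ hγ.1 hγ.2.1 _ (fun ζ hζ => ⟨(hγ.2.2 ζ hζ).1, hJle γ hγ ζ hζ⟩)
  have hJup : ∀ γ ∈ S, J γ ≤ B := by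
    intro γ hγ
    apply csSup_le (hZne.image _)
    rintro _ ⟨ζ, hζ, rfl⟩
    have h5 := (hγ.2.2 ζ hζ).2
    have := hS.nn (γ ζ)
    unfold ii at h5 ⊢
    nlinarith
  have hcl : ∀ a, IsClosed {γ | γ ∈ S ∧ J γ ≤ a} := by
    intro a
    have e : {γ | γ ∈ S ∧ J γ ≤ a} = (⋂ ζ, {γ : C(K, X) | γ (-ζ) = - γ ζ}) ∩
        ((⋂ ζ ∈ bd, {γ : C(K, X) | γ ζ = P ζ}) ∩ (⋂ ζ ∈ Z, ((fun γ : C(K, X) => γ ζ) ⁻¹'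
          ({u | u ∈ Dm ∧ ii ψ Φ lam' u ≤ B} ∩ {u | u ∈ Dm ∧ ii ψ Φ lam u ≤ a})))) := by
      ext γ
      constructor
      · rintro ⟨hγ, hJ⟩
        refine ⟨mem_iInter.2 hγ.1, mem_iInter₂.2 hγ.2.1, mem_iInter₂.2 fun ζ hζ => ?_⟩
        exact ⟨hγ.2.2 ζ hζ, (hγ.2.2 ζ hζ).1, (hJle γ hγ ζ hζ).trans hJ⟩
      · rintro ⟨g1, g2, g3⟩
        rw [mem_iInter] at g1
        rw [mem_iInter₂] at g2 g3
        refine ⟨⟨g1, g2, fun ζ hζ => (g3 ζ hζ).1⟩, ?_⟩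
        apply csSup_le (hZne.image _)
        rintro _ ⟨ζ, hζ, rfl⟩
        exact (g3 ζ hζ).2.2
    rw [e]
    refine (isClosed_iInter fun ζ => ?_).inter ((isClosed_biInter fun ζ _ => ?_).inter
      (isClosed_biInter fun ζ _ => ?_))
    · exact isClosed_eq (continuous_eval_const _) (continuous_eval_const _).neg
    · exact isClosed_eq (continuous_eval_const _) continuous_const
    · exact ((hS.closedI lam' (by linarith) B).inter (hS.closedI lam hlam a)).preimage
        (continuous_eval_const _)
  have h0S : γ0 ∈ S := ⟨h0o, h0P, h0Z⟩
  obtain ⟨γ, hγ, hdist, hek⟩ := ekeland S J hcl (c - ℓ / 2) hJlow γ0 h0S (dl1 / 8) (by linarith)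
  have hγF : ∀ ζ ∈ Z, γ ζ ∈ F := by
    intro ζ hζ
    apply h0F ζ hζ
    have g1 := hJup γ0 h0S
    have g2 := hJlow γ hγ
    have g3 : dl1 / 8 * dist γ0 γ ≤ dl1 / 8 * s := by
      rw [hB] at g1
      linarith
    have g4 := le_of_mul_le_mul_left g3 (by linarith)
    have g5 := ContinuousMap.dist_apply_le_dist (f := γ0) (g := γ) ζ
    rw [← dist_eq_norm, dist_comm]
    linarith
  obtain ⟨CΦ, hCΦ⟩ := (isCompact_univ (X := K)).exists_bound_of_continuousOn
    (f := fun ζ => Φ (γ ζ)) (hS.diff.continuous.comp γ.continuous).continuousOn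
  have hCΦ' : ∀ ζ, Φ (γ ζ) ≤ CΦ := fun ζ => (le_abs_self _).trans (hCΦ ζ (mem_univ _))
  set R := max (M + 3) (max ((B + CΦ) / lam') ((CΦ + 1) / lmax)) with hR
  have hl'pos : 0 < lam' := by linarith
  have hlmpos : 0 < lmax := by linarith
  obtain ⟨t, ht, γ', g1, g2, g3, g4⟩ := core_step hS (lam := lam) (lam' := lam') (c := c) (M := M)
    (δ := δ) (dl1 := dl1) (η := η) (R := R) (a := J γ - ℓ / 2) (b := c + (M + 1) * ℓ - η / 4)
    (lmax := lmax)
    ⟨hlam, h1, by linarith, hc, hM, hδ, hdl1, hη, hηc, d1, d2, d3, by linarith, by linarith,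
      by linarith, by have := hJlow γ hγ; linarith, rfl, le_max_left _ _⟩
    bd Z O hbd hbs hZ hZs hO hbO P hP hPD hPI γ hγ.1 hγ.2.1 hγ.2.2
    (by
      intro ζ hζ
      have g := (hγ.2.2 ζ hζ).2
      unfold ii at g
      refine le_trans ?_ ((le_max_left _ _).trans (le_max_right _ _))
      rw [le_div_iff₀ hl'pos]
      have := hCΦ' ζ
      linarith)
    (by
      intro ζ hζ
      have : (CΦ + 1) / lmax ≤ R := (le_max_right _ _).trans (le_max_right _ _)
      rw [div_le_iff₀ hlmpos] at this
      have := hCΦ' ζ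
      linarith)
    (by
      intro ζ hζ ha hb
      obtain ⟨v, hv, v1, v2, v3⟩ := hPS (γ ζ) (hγ.2.2 ζ hζ).1 (hγF ζ hζ) ha
        (by unfold ii at hb; linarith)
      exact ⟨v, hv, v1, by linarith, v3⟩)
    (ℓ / 2) (by linarith) (by
      intro ζ hζ
      have := hJle γ hγ ζ hζ
      linarith)
  have hγ'S : γ' ∈ S := ⟨g1, g2, fun ζ hζ => ⟨(g3 ζ hζ).1, (g3 ζ hζ).2.1⟩⟩
  have e1 := hek γ' hγ'S
  have e2 : J γ' ≤ J γ - t * dl1 / 2 := by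
    apply csSup_le (hZne.image _)
    rintro _ ⟨ζ, hζ, rfl⟩
    have := (g3 ζ hζ).2.2
    simp only
    linarith
  have e3 : dl1 / 8 * dist γ γ' ≤ dl1 / 8 * (2 * t) := by gcongr
  have e4 : 0 < t * dl1 := by positivity
  linarith

end core
end SMPAn
namespace SMPAn

lemma mono_pt (f : ℝ → ℝ) (a b : ℝ) (hab : a < b) (hf : MonotoneOn f (Icc a b)) :
    ∃ x ∈ Ioo a b, ∃ M ≥ 0, ∃ Δ > 0, ∀ y, x < y → y < x + Δ → y ≤ b ∧ f y ≤ f x + M * (y - x) := by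
  have h1 := (hf.mono Ioo_subset_Icc_self).ae_differentiableWithinAt_of_mem
  obtain ⟨x, hx, hd⟩ : ∃ x ∈ Ioo a b, DifferentiableWithinAt ℝ f (Ioo a b) x := by
    by_contra hcon
    push Not at hcon
    have h2 : ∀ᵐ x, x ∉ Ioo a b := by
      filter_upwards [h1] with x hx hxm
      exact hcon x hxm (hx hxm)
    have h3 : MeasureTheory.volume (Ioo a b) = 0 := by
      rw [MeasureTheory.ae_iff] at h2
      have h4 : {x | ¬ x ∉ Ioo a b} = Ioo a b := by
        ext x; rw [mem_setOf_eq, not_not]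
      rwa [h4] at h2
    rw [Real.volume_Ioo, ENNReal.ofReal_eq_zero] at h3
    linarith
  have hd' : DifferentiableAt ℝ f x := hd.differentiableAt (Ioo_mem_nhds hx.1 hx.2)
  obtain ⟨M, hM, hO⟩ := hd'.isBigO_sub.exists_pos
  rw [Asymptotics.isBigOWith_iff] at hO
  obtain ⟨r, hr, hb⟩ := Metric.eventually_nhds_iff.1 hO
  refine ⟨x, hx, M, hM.le, min r (b - x), lt_min hr (by linarith [hx.2]), fun y h1 h2 => ?_⟩
  have h3 := min_le_left r (b - x)
  have h4 := min_le_right r (b - x)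
  refine ⟨by linarith, ?_⟩
  have h5 := hb (y := y) (by rw [Real.dist_eq, abs_of_pos (by linarith)]; linarith)
  rw [Real.norm_eq_abs, Real.norm_eq_abs, abs_of_pos (show 0 < y - x by linarith)] at h5
  linarith [le_abs_self (f y - f x)]

/-- Finite norming families on finite dimensional subspaces. -/
lemma norming (S : Submodule ℝ X) [FiniteDimensional ℝ S] :
    ∃ fs : List (X →L[ℝ] ℝ), (∀ f ∈ fs, ‖f‖ ≤ 1) ∧ ∀ x ∈ S, x ≠ 0 → ∃ f ∈ fs, ‖x‖ / 2 ≤ f x := by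
  classical
  haveI : ProperSpace S := FiniteDimensional.proper ℝ S
  obtain ⟨t, ht, hfin, hcov⟩ := (isCompact_sphere (0 : S) 1).finite_cover_balls (e := 1 / 2) (by norm_num)
  choose g hg1 hg2 using fun x : S => exists_dual_vector'' ℝ (x : X)
  refine ⟨hfin.toFinset.toList.map g, ?_, ?_⟩
  · intro f hf
    obtain ⟨x, -, rfl⟩ := List.mem_map.1 hf
    exact hg1 x
  · intro x hx hx0
    have hn : 0 < ‖x‖ := norm_pos_iff.2 hx0
    let y : S := (‖x‖⁻¹) • ⟨x, hx⟩
    have hy : ‖y‖ = 1 := by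
      simp only [y, norm_smul, norm_inv, norm_norm]
      exact inv_mul_cancel₀ hn.ne'
    have hy' : y ∈ sphere (0 : S) 1 := by simpa using hy
    obtain ⟨z, hz, hyz⟩ := mem_iUnion₂.1 (hcov hy')
    refine ⟨g z, List.mem_map.2 ⟨z, by simpa using hz, rfl⟩, ?_⟩
    have hz1 : ‖(z : X)‖ = 1 := by
      have := ht hz
      simpa using this
    rw [mem_ball, dist_eq_norm] at hyz
    have hyz' : ‖(y : X) - z‖ < 1 / 2 := by simpa using hyz
    have h1 : |g z ((y : X) - z)| ≤ 1 * ‖(y : X) - z‖ := (g z).le_of_opNorm_le (hg1 z) _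
    rw [map_sub, hg2, RCLike.ofReal_real_eq_id, id, hz1] at h1
    have h2 := (abs_le.1 h1).1
    have h3 : (y : X) = ‖x‖⁻¹ • x := rfl
    rw [h3, map_smul, smul_eq_mul] at h2
    rw [h3] at hyz'
    have h4 : 1 / 2 ≤ ‖x‖⁻¹ * g z x := by linarith
    have h5 : ‖x‖ * (1 / 2) ≤ ‖x‖ * (‖x‖⁻¹ * g z x) := by gcongr
    rw [← mul_assoc, mul_inv_cancel₀ hn.ne', one_mul] at h5
    linarith

/-- Whitley style construction: a bounded sequence with all weak cluster points zero. -/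
lemma weak_null (Q : ℕ → X → Prop)
    (hQ : ∀ (fs : List (X →L[ℝ] ℝ)) (n : ℕ), ∃ u, (∀ f ∈ fs, f u = 0) ∧ Q n u) :
    ∃ u : ℕ → X, (∀ n, Q n (u n)) ∧ ∀ (φ : ℕ → ℕ) (w : X), StrictMono φ →
      (∀ f : X →L[ℝ] ℝ, Tendsto (fun j => f (u (φ j))) atTop (𝓝 (f w))) → w = 0 := by
  classical
  have hnorm : ∀ L : List X, ∃ fs : List (X →L[ℝ] ℝ), (∀ f ∈ fs, ‖f‖ ≤ 1) ∧
      ∀ x ∈ Submodule.span ℝ {y | y ∈ L}, x ≠ 0 → ∃ f ∈ fs, ‖x‖ / 2 ≤ f x := by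
    intro L
    haveI : FiniteDimensional ℝ (Submodule.span ℝ {y | y ∈ L}) :=
      FiniteDimensional.span_of_finite ℝ (List.finite_toSet L)
    exact norming _
  choose fs hfs1 hfs2 using hnorm
  choose nx hnx1 hnx2 using fun L : List X => hQ (L.tails.flatMap fs) L.length
  obtain ⟨Ls, hL0, hL⟩ : ∃ Ls : ℕ → List X, Ls 0 = [] ∧ ∀ n, Ls (n + 1) = nx (Ls n) :: Ls n :=
    ⟨fun n => Nat.rec [] (fun _ L => nx L :: L) n, rfl, fun n => rfl⟩
  have hlen : ∀ n, (Ls n).length = n := by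
    intro n
    induction n with
    | zero => simp [hL0]
    | succ n ih => simp [hL, ih]
  have hsuf : ∀ n k, Ls n <:+ Ls (n + k) := by
    intro n k
    induction k with
    | zero => exact List.suffix_refl _
    | succ k ih =>
      have : Ls (n + (k + 1)) = nx (Ls (n + k)) :: Ls (n + k) := hL (n + k)
      rw [this]
      exact ih.trans (List.suffix_cons _ _)
  have hmem : ∀ n k, n < k → nx (Ls n) ∈ Ls k := by
    intro n k h
    obtain ⟨a, rfl⟩ := Nat.exists_eq_add_of_lt h
    have h1 := hsuf (n + 1) a
    have e : n + 1 + a = n + a + 1 := by omega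
    rw [e] at h1
    refine h1.subset ?_
    rw [hL]
    simp
  have hvan : ∀ n k, n ≤ k → ∀ f ∈ fs (Ls n), f (nx (Ls k)) = 0 := by
    intro n k h f hf
    apply hnx1
    obtain ⟨a, rfl⟩ := Nat.exists_eq_add_of_le h
    exact List.mem_flatMap.2 ⟨Ls n, (List.mem_tails _ _).2 (hsuf n a), hf⟩
  refine ⟨fun n => nx (Ls n), fun n => ?_, ?_⟩
  · have := hnx2 (Ls n)
    rwa [hlen] at this
  intro φ w hφ hw
  -- w lies in the closed span
  let S : Submodule ℝ X := Submodule.span ℝ (range fun n => nx (Ls n))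
  have hwS : w ∈ closure (S : Set X) := by
    by_contra hcon
    obtain ⟨f, r, h1, h2⟩ := geometric_hahn_banach_closed_point
      (S.convex.closure) isClosed_closure hcon
    have : f w ≤ r := le_of_tendsto' (hw f)
      (fun j => (h1 _ (subset_closure (Submodule.subset_span ⟨φ j, rfl⟩))).le)
    linarith
  have hwv : ∀ n, ∀ f ∈ fs (Ls n), f w = 0 := by
    intro n f hf
    refine tendsto_nhds_unique (hw f) ?_
    refine tendsto_const_nhds.congr' ?_
    filter_upwards [eventually_ge_atTop n] with j hj
    exact (hvan n (φ j) (hj.trans (hφ.id_le j)) f hf).symm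
  have hSn : ∀ x ∈ S, ∃ n, x ∈ Submodule.span ℝ {y | y ∈ Ls n} := by
    intro x hx
    induction hx using Submodule.span_induction with
    | mem x hx =>
      obtain ⟨n, rfl⟩ := hx
      exact ⟨n + 1, Submodule.subset_span (hmem n (n + 1) (by omega))⟩
    | zero => exact ⟨0, Submodule.zero_mem _⟩
    | add x y _ _ hx hy =>
      obtain ⟨n, hn⟩ := hx
      obtain ⟨k, hk⟩ := hy
      refine ⟨n + k, Submodule.add_mem _ ?_ ?_⟩
      · exact Submodule.span_mono (fun y hy => (hsuf n k).subset hy) hn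
      · rw [add_comm]
        exact Submodule.span_mono (fun y hy => (hsuf k n).subset hy) hk
    | smul a x _ hx =>
      obtain ⟨n, hn⟩ := hx
      exact ⟨n, Submodule.smul_mem _ _ hn⟩
  have hest : ∀ e > 0, ‖w‖ ≤ 3 * e := by
    intro e he
    obtain ⟨x, hx, hd⟩ := Metric.mem_closure_iff.1 hwS e he
    rw [dist_eq_norm] at hd
    have h0 : ‖w‖ ≤ ‖w - x‖ + ‖x‖ := by
      have := norm_add_le (w - x) x
      simpa using this
    by_cases hx0 : x = 0
    · subst hx0; simp at h0 hd; linarith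
    obtain ⟨n, hn⟩ := hSn x hx
    obtain ⟨f, hf, h1⟩ := hfs2 (Ls n) x hn hx0
    have h2 : |f (w - x)| ≤ 1 * ‖w - x‖ := f.le_of_opNorm_le (hfs1 _ f hf) _
    rw [map_sub, hwv n f hf, zero_sub, abs_neg] at h2
    have := le_abs_self (f x)
    linarith
  have : ‖w‖ ≤ 0 := by
    by_contra hcon
    push Not at hcon
    have := hest (‖w‖ / 4) (by linarith)
    linarith
  exact norm_le_zero_iff.1 this

variable {Dm : Set X} {ψ Φ : X → ℝ}

lemma Setup.gap (hS : Setup Dm ψ Φ) (lam ρ : ℝ) (hlam : 0 < lam) (hρ : 0 < ρ) :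
    ∃ (fs : List (X →L[ℝ] ℝ)), ∃ ν > 0, ∀ u ∈ Dm, ‖u‖ = ρ → (∀ f ∈ fs, f u = 0) →
      -Φ 0 + ν ≤ ii ψ Φ lam u := by
  by_contra hcon
  push Not at hcon
  obtain ⟨u, hu, hnull⟩ := weak_null
    (fun n u => u ∈ Dm ∧ ‖u‖ = ρ ∧ ii ψ Φ lam u < -Φ 0 + 1 / ((n : ℝ) + 1)) (by
      intro fs n
      obtain ⟨u, h1, h2, h3, h4⟩ := hcon fs (1 / ((n : ℝ) + 1)) (by positivity)
      exact ⟨u, h3, h1, h2, h4⟩)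
  have hub : IsBounded (range u) := isBounded_iff_forall_norm_le.2 ⟨ρ, by
    rintro _ ⟨n, rfl⟩
    exact (hu n).2.1.le⟩
  obtain ⟨φ, w, hφ, hw, -⟩ := hS.h2 u hub
  obtain rfl := hnull φ w hφ hw
  -- mean value theorem
  have hmvt : ∀ n, ∃ θ ∈ Ioo (0 : ℝ) 1, Φ (u n) - Φ 0 = fderiv ℝ Φ (θ • u n) (u n) := by
    intro n
    have hd : ∀ t : ℝ, HasDerivAt (fun t : ℝ => Φ (t • u n)) (fderiv ℝ Φ (t • u n) (u n)) t := by
      intro t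
      have h1 : HasDerivAt (fun t : ℝ => t • u n) (u n) t := by
        simpa using (hasDerivAt_id t).smul_const (u n)
      exact (hS.hasF (t • u n)).comp_hasDerivAt t h1
    obtain ⟨θ, hθ, h⟩ := exists_hasDerivAt_eq_slope (fun t : ℝ => Φ (t • u n))
      (fun t => fderiv ℝ Φ (t • u n) (u n)) (a := 0) (b := 1) one_pos
      (fun t _ => (hd t).continuousAt.continuousWithinAt) (fun t _ => hd t)
    refine ⟨θ, hθ, ?_⟩
    rw [h]; simp
  choose θ hθ hmv using hmvt
  have hz : IsBounded (range fun n => θ (φ n) • u (φ n)) := isBounded_iff_forall_norm_le.2 ⟨ρ, by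
    rintro _ ⟨n, rfl⟩
    simp only
    rw [norm_smul, Real.norm_eq_abs, abs_of_pos (hθ _).1, (hu _).2.1]
    have := (hθ (φ n)).2
    nlinarith⟩
  obtain ⟨φ', z, hφ', hzw, hlow⟩ := hS.h2 _ hz
  have hz0 : z = 0 := by
    refine NormedSpace.eq_zero_of_forall_dual_eq_zero ℝ (fun f => ?_)
    refine tendsto_nhds_unique (hzw f) ?_
    have h1 := ((hw f).comp hφ'.tendsto_atTop).abs
    rw [map_zero, abs_zero] at h1
    refine squeeze_zero_norm (fun n => ?_) h1
    rw [map_smul, smul_eq_mul, norm_mul, Real.norm_eq_abs, Real.norm_eq_abs, abs_of_pos (hθ _).1]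
    have := (hθ (φ (φ' n))).2
    have := abs_nonneg (f (u (φ (φ' n))))
    simp only [Function.comp]
    nlinarith
  subst hz0
  have hd0 : fderiv ℝ Φ 0 = 0 := by
    have := hS.fderivNeg 0
    rw [neg_zero] at this
    ext v
    have h1 := DFunLike.congr_fun this v
    rw [ContinuousLinearMap.neg_apply] at h1
    rw [ContinuousLinearMap.zero_apply]
    linarith
  have hup : ∀ e > 0, ∀ᶠ n in atTop, Φ (u (φ (φ' n))) - Φ 0 ≤ e := by
    intro e he
    have hc := hS.fderivCont.tendsto 0
    rw [hd0] at hc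
    obtain ⟨r, hr, hcr⟩ := Metric.eventually_nhds_iff.1
      ((Metric.tendsto_nhds.1 hc) (e / ρ) (by positivity))
    have h1 := hlow 0 (-(e * (r / ρ))) (by
      simp only [sub_self, map_zero]
      have : 0 < e * (r / ρ) := by positivity
      linarith)
    filter_upwards [h1] with n hn
    rw [hmv]
    have hth := hθ (φ (φ' n))
    have hnu := (hu (φ (φ' n))).2.1
    simp only [zero_sub, map_neg, map_smul, smul_eq_mul] at hn
    by_cases hs : θ (φ (φ' n)) < r / ρ
    · have h2 := hcr (y := θ (φ (φ' n)) • u (φ (φ' n))) (by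
        rw [dist_zero_right, norm_smul, Real.norm_eq_abs, abs_of_pos hth.1, hnu]
        rwa [lt_div_iff₀ hρ] at hs)
      rw [dist_zero_right] at h2
      refine (le_abs_self _).trans (((fderiv ℝ Φ _).le_of_opNorm_le h2.le _).trans ?_)
      rw [hnu, div_mul_cancel₀ _ hρ.ne']
    · push Not at hs
      have h3 : θ (φ (φ' n)) * (fderiv ℝ Φ (θ (φ (φ' n)) • u (φ (φ' n)))) (u (φ (φ' n))) ≤
          θ (φ (φ' n)) * e := by
        have : e * (r / ρ) ≤ e * θ (φ (φ' n)) := by gcongr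
        linarith
      exact le_of_mul_le_mul_left h3 hth.1
  have hw' : ∀ f : X →L[ℝ] ℝ, Tendsto (fun j => f (u (φ (φ' j)))) atTop (𝓝 (f 0)) :=
    fun f => (hw f).comp hφ'.tendsto_atTop
  have h0 : Tendsto (fun n : ℕ => (1 : ℝ) / ((n : ℝ) + 1)) atTop (𝓝 0) :=
      tendsto_one_div_add_atTop_nhds_zero_nat
  have h0' := h0.comp (hφ.comp hφ').tendsto_atTop
  have hψ : Tendsto (fun j => ψ (u (φ (φ' j)))) atTop (𝓝 (ψ 0)) := by
    refine hS.psiBound _ 0 (fun n => (hu _).1) hw' ?_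
    intro e he
    filter_upwards [hup (lam * e / 2) (by positivity),
      h0'.eventually_lt_const (show 0 < lam * e / 2 by positivity)] with n h1 h2
    have h3 := (hu (φ (φ' n))).2.2
    simp only [Function.comp] at h2
    unfold ii at h3
    rw [hS.psi0, zero_add]
    have : lam * ψ (u (φ (φ' n))) ≤ lam * e := by linarith
    exact le_of_mul_le_mul_left this hlam
  have hst := hS.h3 _ 0 (fun n => (hu _).1) hS.zero_mem hw' hψ
  have hn := hst.norm
  simp only [(hu _).2.1, norm_zero] at hn
  have := tendsto_nhds_unique tendsto_const_nhds hn
  linarith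

end SMPAn
namespace SMPAn

/-- Real form of the symmetric mountain pass geometry. -/
structure Geo (Dm : Set X) (ψ Φ : X → ℝ) (ρ α ε : ℝ)
    (π : (k : ℕ) → EuclideanSpace ℝ (Fin k) → X) : Prop where
  rpos : 0 < ρ
  apos : 0 < α
  epos : 0 < ε
  elt : ε < 1
  inf : ∀ u ∈ Dm, ‖u‖ = ρ → α ≤ ii ψ Φ (1 - ε) u
  cont : ∀ k, 1 ≤ k → ContinuousOn (π k) (sphere (0 : EuclideanSpace ℝ (Fin k)) 1)
  odd : ∀ k, 1 ≤ k → ∀ ζ ∈ sphere (0 : EuclideanSpace ℝ (Fin k)) 1, π k (-ζ) = - π k ζ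
  big : ∀ k, 1 ≤ k → ∀ ζ ∈ sphere (0 : EuclideanSpace ℝ (Fin k)) 1, ρ < ‖π k ζ‖
  dm : ∀ k, 1 ≤ k → ∀ ζ ∈ sphere (0 : EuclideanSpace ℝ (Fin k)) 1, π k ζ ∈ Dm
  neg : ∀ k, 1 ≤ k → ∀ ζ ∈ sphere (0 : EuclideanSpace ℝ (Fin k)) 1, ii ψ Φ (1 + ε) (π k ζ) ≤ 0

/-- The closed disk as a type. -/
abbrev Kb (m : ℕ) : Type := ↥(closedBall (0 : EuclideanSpace ℝ (Fin m)) 1)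

/-- Admissible maps. -/
def Adm (π : (k : ℕ) → EuclideanSpace ℝ (Fin k) → X) (m : ℕ) (γ : C(Kb m, X)) : Prop :=
  (∀ ζ, γ (-ζ) = - γ ζ) ∧ ∀ ζ : Kb m, ‖(ζ : EuclideanSpace ℝ (Fin m))‖ = 1 → γ ζ = π m ζ

/-- The radial retraction onto the disk. -/
def rr (m : ℕ) : C(EuclideanSpace ℝ (Fin m), Kb m) where
  toFun x := ⟨(max 1 ‖x‖)⁻¹ • x, by
    rw [mem_closedBall_zero_iff, norm_smul, norm_inv, Real.norm_eq_abs,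
      abs_of_pos (lt_max_of_lt_left one_pos), inv_mul_le_iff₀ (lt_max_of_lt_left one_pos), mul_one]
    exact le_max_right _ _⟩
  continuous_toFun := by
    refine Continuous.subtype_mk ?_ _
    have h1 : Continuous (fun x : EuclideanSpace ℝ (Fin m) => max 1 ‖x‖) := by fun_prop
    exact (h1.inv₀ (fun x => (lt_max_of_lt_left one_pos).ne')).smul continuous_id

lemma rr_coe {m : ℕ} (ζ : Kb m) : rr m ζ = ζ := by
  ext1
  have : ‖(ζ : EuclideanSpace ℝ (Fin m))‖ ≤ 1 := mem_closedBall_zero_iff.1 ζ.2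
  simp [rr, max_eq_left this]

lemma rr_neg {m : ℕ} (x : EuclideanSpace ℝ (Fin m)) : rr m (-x) = - rr m x := by
  ext1
  simp [rr]

lemma rr_norm {m : ℕ} (x : EuclideanSpace ℝ (Fin m)) (hx : 1 ≤ ‖x‖) :
    ‖(rr m x : EuclideanSpace ℝ (Fin m))‖ = 1 := by
  have : 0 < ‖x‖ := by linarith
  simp [rr, max_eq_right hx, norm_smul, this.ne']

variable {Dm : Set X} {ψ Φ : X → ℝ} {ρ α ε : ℝ} {π : (k : ℕ) → EuclideanSpace ℝ (Fin k) → X}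

lemma LB (hG : Geo Dm ψ Φ ρ α ε π) (m : ℕ) (hm : 1 ≤ m) (γ : C(Kb m, X)) (hγ : Adm π m γ)
    (hs : List C(Kb m, ℝ)) (hodd : ∀ h ∈ hs, ∀ ζ, h (-ζ) = - h ζ) (hlen : hs.length < m) :
    ∃ ζ, (∀ h ∈ hs, h ζ = 0) ∧ ‖γ ζ‖ = ρ := by
  obtain ⟨x, h1, h2⟩ := SMPTop.TL m (hs.map (fun h => fun x => h (rr m x))) (by simpa using hlen)
    (by
      intro g hg
      obtain ⟨h, hh, rfl⟩ := List.mem_map.1 hg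
      fun_prop)
    (by
      intro g hg x
      obtain ⟨h, hh, rfl⟩ := List.mem_map.1 hg
      simp only [rr_neg]
      exact hodd h hh _)
    (fun x => ‖γ (rr m x)‖ - ρ) (by fun_prop)
    (by intro x; simp only [rr_neg, hγ.1, norm_neg])
    (by
      have h0 : γ (rr m 0) = - γ (rr m 0) := by
        rw [← hγ.1, ← rr_neg, neg_zero]
      have : (2 : ℝ) • γ (rr m 0) = 0 := by
        rw [two_smul]; nth_rewrite 2 [h0]; simp
      have : γ (rr m 0) = 0 := by simpa using this
      simp only [this, norm_zero]
      linarith [hG.rpos])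
    (by
      intro x hx
      have h3 := rr_norm x hx
      simp only [hγ.2 _ h3]
      linarith [hG.big m hm _ (mem_sphere_zero_iff_norm.2 h3)])
  refine ⟨rr m x, fun h hh => h2 _ (List.mem_map.2 ⟨h, hh, rfl⟩), ?_⟩
  linarith

/-- The radial extension of the boundary map. -/
def PP (π : (k : ℕ) → EuclideanSpace ℝ (Fin k) → X) (m : ℕ) (ζ : Kb m) : X :=
  π m (‖(ζ : EuclideanSpace ℝ (Fin m))‖⁻¹ • (ζ : EuclideanSpace ℝ (Fin m)))

lemma PP_mem {m : ℕ} (ζ : Kb m) (h : (ζ : EuclideanSpace ℝ (Fin m)) ≠ 0) :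
    ‖(ζ : EuclideanSpace ℝ (Fin m))‖⁻¹ • (ζ : EuclideanSpace ℝ (Fin m)) ∈
      sphere (0 : EuclideanSpace ℝ (Fin m)) 1 := by
  rw [mem_sphere_zero_iff_norm, norm_smul, norm_inv, norm_norm]
  exact inv_mul_cancel₀ (norm_ne_zero_iff.2 h)

lemma PP_cont (hG : Geo Dm ψ Φ ρ α ε π) (m : ℕ) (hm : 1 ≤ m) :
    ContinuousOn (PP π m) {ζ : Kb m | (ζ : EuclideanSpace ℝ (Fin m)) ≠ 0} := by
  refine (hG.cont m hm).comp (t := sphere (0 : EuclideanSpace ℝ (Fin m)) 1) ?_ (fun ζ hζ => PP_mem ζ hζ)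
  have h1 : Continuous (fun ζ : Kb m => ‖(ζ : EuclideanSpace ℝ (Fin m))‖) := by fun_prop
  have h2 : Continuous (fun ζ : Kb m => (ζ : EuclideanSpace ℝ (Fin m))) := by fun_prop
  exact (h1.continuousOn.inv₀ (fun ζ hζ => norm_ne_zero_iff.2 hζ)).smul h2.continuousOn

lemma PP_bd {m : ℕ} (ζ : Kb m) (h : ‖(ζ : EuclideanSpace ℝ (Fin m))‖ = 1) :
    PP π m ζ = π m ζ := by
  simp [PP, h]

lemma coreK [CompleteSpace X] (hS : Setup Dm ψ Φ) (hG : Geo Dm ψ Φ ρ α ε π)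
    (lam c M s : ℝ) (hlam : 0 < lam)
    (hlmax : lam < 1 + ε) (hc : 0 < c) (hM : 0 ≤ M) (hs : 0 < s) (F : Set X) (hF : IsClosed F)
    (hno : ∀ u ∈ F, Crit Dm ψ Φ lam u → lam * ψ u - Φ u = c → ψ u ≤ M + 2 → False) :
    ∃ Δ > 0, ∀ lam', lam < lam' → lam' < lam + Δ →
      ∀ (m : ℕ) (_hm : 1 ≤ m) (Z : Set (Kb m))
        (_hZ : IsClosed Z) (_hZs : ∀ ζ ∈ Z, -ζ ∈ Z)
        (γ0 : C(Kb m, X)) (_h0o : Adm π m γ0)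
        (_h0Z : ∀ ζ ∈ Z, γ0 ζ ∈ Dm ∧ ii ψ Φ lam' (γ0 ζ) ≤ c + (M + 1) * (lam' - lam))
        (_h0F : ∀ ζ ∈ Z, ∀ x, ‖x - γ0 ζ‖ ≤ s → x ∈ F)
        (_hmm : ∀ γ : C(Kb m, X), Adm π m γ →
          ∀ b, (∀ ζ ∈ Z, γ ζ ∈ Dm ∧ ii ψ Φ lam (γ ζ) ≤ b) → c - (lam' - lam) / 2 ≤ b), False := by
  obtain ⟨Δ, hΔ, H⟩ := core hS lam c M s (1 + ε) hlam hlmax hc hM hs F hF hno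
  refine ⟨Δ, hΔ, fun lam' h1 h2 m hm Z hZ hZs γ0 h0 h0Z h0F hmm => ?_⟩
  refine H lam' h1 h2 (Kb m) {ζ | ‖(ζ : EuclideanSpace ℝ (Fin m))‖ = 1} Z
    {ζ | (ζ : EuclideanSpace ℝ (Fin m)) ≠ 0} ?_ ?_ hZ hZs ?_ ?_ (PP π m) (PP_cont hG m hm) ?_ ?_
    γ0 h0.1 ?_ h0Z h0F ?_
  · exact isClosed_eq (by fun_prop) continuous_const
  · intro ζ hζ
    simpa using hζ
  · exact isOpen_ne_fun (by fun_prop) continuous_const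
  · intro ζ hζ h
    rw [mem_setOf_eq, h, norm_zero] at hζ
    exact zero_ne_one hζ
  · intro ζ hζ
    exact hG.dm m hm _ (PP_mem ζ hζ)
  · intro ζ hζ
    exact hG.neg m hm _ (PP_mem ζ hζ)
  · intro ζ hζ
    rw [h0.2 ζ hζ, PP_bd ζ hζ]
  · intro γ g1 g2
    exact hmm γ ⟨g1, fun ζ hζ => by rw [g2 ζ hζ, PP_bd ζ hζ]⟩

lemma cone_ex (hS : Setup Dm ψ Φ) (hG : Geo Dm ψ Φ ρ α ε π) (m : ℕ) (hm : 1 ≤ m) :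
    ∃ γ : C(Kb m, X), Adm π m γ ∧ ∃ b, ∀ ζ, γ ζ ∈ Dm ∧ ii ψ Φ (1 + ε) (γ ζ) ≤ b := by
  have hΦc : Continuous Φ := hS.diff.continuous
  -- bounds on the sphere
  have hcomp : IsCompact (sphere (0 : EuclideanSpace ℝ (Fin m)) 1) := isCompact_sphere _ _
  obtain ⟨B, hB⟩ := (hcomp.image_of_continuousOn (hG.cont m hm)).isBounded.exists_norm_le
  obtain ⟨B2, hB2⟩ := (hcomp.image_of_continuousOn
    (hΦc.comp_continuousOn (hG.cont m hm))).isBounded.exists_norm_le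
  have hB' : ∀ ζ ∈ sphere (0 : EuclideanSpace ℝ (Fin m)) 1, ‖π m ζ‖ ≤ B :=
    fun ζ h => hB _ (mem_image_of_mem _ h)
  have hB2' : ∀ ζ ∈ sphere (0 : EuclideanSpace ℝ (Fin m)) 1, |Φ (π m ζ)| ≤ B2 :=
    fun ζ h => hB2 _ (mem_image_of_mem _ h)
  let g : Kb m → X := fun ζ => ‖(ζ : EuclideanSpace ℝ (Fin m))‖ • PP π m ζ
  have hg : Continuous g := by
    rw [continuous_iff_continuousAt]
    intro ζ
    by_cases hζ : (ζ : EuclideanSpace ℝ (Fin m)) = 0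
    · have hB0 : ∀ x : Kb m, ‖g x‖ ≤ B * ‖(x : EuclideanSpace ℝ (Fin m))‖ := by
        intro x
        by_cases hx : (x : EuclideanSpace ℝ (Fin m)) = 0
        · simp [g, hx]
        · rw [norm_smul, norm_norm, mul_comm]
          exact mul_le_mul_of_nonneg_right (hB' _ (PP_mem x hx)) (norm_nonneg _)
      have : g ζ = 0 := by simp [g, hζ]
      unfold ContinuousAt
      rw [this]
      refine squeeze_zero_norm hB0 ?_
      have h1 : Continuous (fun x : Kb m => B * ‖(x : EuclideanSpace ℝ (Fin m))‖) := by fun_prop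
      have h2 := h1.tendsto ζ
      rwa [hζ, norm_zero, mul_zero] at h2
    · have ho : IsOpen {ζ : Kb m | (ζ : EuclideanSpace ℝ (Fin m)) ≠ 0} :=
        isOpen_ne_fun (by fun_prop) continuous_const
      have h1 := (PP_cont hG m hm).continuousAt (ho.mem_nhds hζ)
      exact ContinuousAt.smul (by fun_prop) h1
  refine ⟨⟨g, hg⟩, ⟨?_, ?_⟩, ?_⟩
  · intro ζ
    simp only [ContinuousMap.coe_mk, g]
    by_cases hζ : (ζ : EuclideanSpace ℝ (Fin m)) = 0
    · simp [hζ]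
    · have h1 : PP π m (-ζ) = - PP π m ζ := by
        rw [PP, PP, ← hG.odd m hm _ (PP_mem ζ hζ)]
        simp
      rw [h1]; simp
  · intro ζ hζ
    simp only [ContinuousMap.coe_mk, g]
    rw [PP_bd ζ hζ, hζ, one_smul]
  · obtain ⟨B3, hB3⟩ := (isCompact_range (hΦc.comp hg)).isBounded.exists_norm_le
    refine ⟨max B2 0 + B3, fun ζ => ?_⟩
    have hb3 : |Φ (g ζ)| ≤ B3 := hB3 _ ⟨ζ, rfl⟩
    have hb3' := (abs_le.1 hb3).1
    have h2 := le_max_left B2 0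
    have h3 := le_max_right B2 0
    simp only [ContinuousMap.coe_mk]
    by_cases hζ : (ζ : EuclideanSpace ℝ (Fin m)) = 0
    · have h1 : g ζ = 0 := by simp [g, hζ]
      rw [h1] at hb3' ⊢
      refine ⟨hS.zero_mem, ?_⟩
      rw [ii, hS.psi0]
      linarith
    · have hm1 := PP_mem ζ hζ
      have hn1 : ‖(ζ : EuclideanSpace ℝ (Fin m))‖ ≤ 1 := mem_closedBall_zero_iff.1 ζ.2
      have h4 := hS.conv _ (hG.dm m hm _ hm1) 0 hS.zero_mem ‖(ζ : EuclideanSpace ℝ (Fin m))‖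
        (1 - ‖(ζ : EuclideanSpace ℝ (Fin m))‖) (norm_nonneg _) (by linarith) (by ring)
      rw [smul_zero, add_zero, hS.psi0, mul_zero, add_zero] at h4
      refine ⟨h4.1, ?_⟩
      have h5 := h4.2
      have h6 := hG.neg m hm _ hm1
      have h7 := (abs_le.1 (hB2' _ hm1)).2
      have h8 := hS.nn (π m (‖(ζ : EuclideanSpace ℝ (Fin m))‖⁻¹ • (ζ : EuclideanSpace ℝ (Fin m))))
      have h9 := hG.epos
      change (1 + ε) * ψ (g ζ) - Φ (g ζ) ≤ _
      have h10 : ψ (g ζ) ≤ ψ (π m (‖(ζ : EuclideanSpace ℝ (Fin m))‖⁻¹ • (ζ : EuclideanSpace ℝ (Fin m)))) := by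
        refine h5.trans ?_
        exact mul_le_of_le_one_left h8 hn1
      have h11 := mul_le_mul_of_nonneg_left h10 (show 0 ≤ 1 + ε by linarith)
      unfold ii at h6
      linarith

/-- Generic minimax value. -/
def val (Dm : Set X) (ψ Φ : X → ℝ) (A : Set (Set X)) (lam : ℝ) : ℝ :=
  sInf {x : ℝ | ∃ S ∈ A, ∀ u ∈ S, u ∈ Dm ∧ ii ψ Φ lam u ≤ x}

/-- Properties of a minimax family. -/
structure Fam (Dm : Set X) (ψ Φ : X → ℝ) (ρ ε : ℝ) (A : Set (Set X)) : Prop where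
  ne : ∃ S ∈ A, ∃ b, ∀ u ∈ S, u ∈ Dm ∧ ii ψ Φ (1 + ε) u ≤ b
  link : ∀ S ∈ A, ∃ u ∈ S, ‖u‖ = ρ

lemma ii_mono (hS : Setup Dm ψ Φ) {l l' : ℝ} (h : l ≤ l') (u : X) : ii ψ Φ l u ≤ ii ψ Φ l' u := by
  have := mul_le_mul_of_nonneg_right h (hS.nn u)
  unfold ii; linarith

section ValSec
variable {A : Set (Set X)}

lemma val_bdd (hS : Setup Dm ψ Φ) (hG : Geo Dm ψ Φ ρ α ε π) (hA : Fam Dm ψ Φ ρ ε A) {lam : ℝ}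
    (h1 : 1 - ε ≤ lam) : ∀ x ∈ {x : ℝ | ∃ S ∈ A, ∀ u ∈ S, u ∈ Dm ∧ ii ψ Φ lam u ≤ x}, α ≤ x := by
  rintro x ⟨S, hSA, hx⟩
  obtain ⟨u, hu, hn⟩ := hA.link S hSA
  exact (hG.inf u (hx u hu).1 hn).trans ((ii_mono hS h1 u).trans (hx u hu).2)

lemma val_ne (hS : Setup Dm ψ Φ) (hA : Fam Dm ψ Φ ρ ε A) {lam : ℝ}
    (h1 : lam ≤ 1 + ε) : {x : ℝ | ∃ S ∈ A, ∀ u ∈ S, u ∈ Dm ∧ ii ψ Φ lam u ≤ x}.Nonempty := by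
  obtain ⟨S, hSA, b, hb⟩ := hA.ne
  exact ⟨b, S, hSA, fun u hu => ⟨(hb u hu).1, (ii_mono hS h1 u).trans (hb u hu).2⟩⟩

lemma val_ge (hS : Setup Dm ψ Φ) (hG : Geo Dm ψ Φ ρ α ε π) (hA : Fam Dm ψ Φ ρ ε A) {lam : ℝ}
    (h1 : 1 - ε ≤ lam) (h2 : lam ≤ 1 + ε) : α ≤ val Dm ψ Φ A lam :=
  le_csInf (val_ne hS hA h2) (val_bdd hS hG hA h1)

lemma val_le (hS : Setup Dm ψ Φ) (hG : Geo Dm ψ Φ ρ α ε π) (hA : Fam Dm ψ Φ ρ ε A) {lam : ℝ}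
    (h1 : 1 - ε ≤ lam) {S : Set X} (hSA : S ∈ A) {x : ℝ}
    (hx : ∀ u ∈ S, u ∈ Dm ∧ ii ψ Φ lam u ≤ x) : val Dm ψ Φ A lam ≤ x :=
  csInf_le ⟨α, val_bdd hS hG hA h1⟩ ⟨S, hSA, hx⟩

lemma val_ex (hS : Setup Dm ψ Φ) (hA : Fam Dm ψ Φ ρ ε A) {lam : ℝ} (h2 : lam ≤ 1 + ε) {x : ℝ}
    (hx : val Dm ψ Φ A lam < x) : ∃ S ∈ A, ∀ u ∈ S, u ∈ Dm ∧ ii ψ Φ lam u ≤ x := by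
  obtain ⟨y, ⟨S, hSA, hy⟩, hyx⟩ := exists_lt_of_csInf_lt (val_ne hS hA h2) hx
  exact ⟨S, hSA, fun u hu => ⟨(hy u hu).1, (hy u hu).2.trans hyx.le⟩⟩

lemma val_mono (hS : Setup Dm ψ Φ) (hG : Geo Dm ψ Φ ρ α ε π) (hA : Fam Dm ψ Φ ρ ε A) {l l' : ℝ}
    (h1 : 1 - ε ≤ l) (h : l ≤ l') (h2 : l' ≤ 1 + ε) : val Dm ψ Φ A l ≤ val Dm ψ Φ A l' := by
  refine csInf_le_csInf ⟨α, val_bdd hS hG hA h1⟩ (val_ne hS hA h2) ?_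
  rintro x ⟨S, hSA, hx⟩
  exact ⟨S, hSA, fun u hu => ⟨(hx u hu).1, (ii_mono hS h u).trans (hx u hu).2⟩⟩

lemma val_anti (hS : Setup Dm ψ Φ) (hG : Geo Dm ψ Φ ρ α ε π) (hA : Fam Dm ψ Φ ρ ε A)
    {B : Set (Set X)} (hB : Fam Dm ψ Φ ρ ε B) (hBA : B ⊆ A) {l : ℝ}
    (h1 : 1 - ε ≤ l) (h2 : l ≤ 1 + ε) : val Dm ψ Φ A l ≤ val Dm ψ Φ B l := by
  refine csInf_le_csInf ⟨α, val_bdd hS hG hA h1⟩ (val_ne hS hB h2) ?_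
  rintro x ⟨S, hSA, hx⟩
  exact ⟨S, hBA hSA, hx⟩

end ValSec

end SMPAn
namespace SMPAn
variable {Dm : Set X} {ψ Φ : X → ℝ} {ρ α ε : ℝ} {π : (k : ℕ) → EuclideanSpace ℝ (Fin k) → X}

/-- The family of ranges of admissible maps. -/
def famA (π : (k : ℕ) → EuclideanSpace ℝ (Fin k) → X) (k : ℕ) : Set (Set X) :=
  {S | ∃ γ : C(Kb k, X), Adm π k γ ∧ S = range γ}

lemma famA_fam (hS : Setup Dm ψ Φ) (hG : Geo Dm ψ Φ ρ α ε π) (k : ℕ) (hk : 1 ≤ k) :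
    Fam Dm ψ Φ ρ ε (famA π k) where
  ne := by
    obtain ⟨γ, hγ, b, hb⟩ := cone_ex hS hG k hk
    refine ⟨range γ, ⟨γ, hγ, rfl⟩, b, ?_⟩
    rintro _ ⟨ζ, rfl⟩
    exact hb ζ
  link := by
    rintro _ ⟨γ, hγ, rfl⟩
    obtain ⟨ζ, -, h⟩ := LB hG k hk γ hγ [] (by simp) (by simp; omega)
    exact ⟨γ ζ, ⟨ζ, rfl⟩, h⟩

lemma levelCrit [CompleteSpace X] (hS : Setup Dm ψ Φ) (hG : Geo Dm ψ Φ ρ α ε π) (k : ℕ) (hk : 1 ≤ k)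
    (a b : ℝ) (h1 : 1 - ε ≤ a) (hab : a < b) (h2 : b ≤ 1 + ε) :
    ∃ lam ∈ Ioo a b, ∃ u, Crit Dm ψ Φ lam u ∧ ii ψ Φ lam u = val Dm ψ Φ (famA π k) lam := by
  have hA := famA_fam hS hG k hk
  obtain ⟨lam, hlam, M, hM, Δ, hΔ, hd⟩ := mono_pt (val Dm ψ Φ (famA π k)) a b hab
    (fun x hx y hy hxy => val_mono hS hG hA (h1.trans hx.1) hxy (hy.2.trans h2))
  refine ⟨lam, hlam, ?_⟩
  by_contra hcon
  push Not at hcon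
  have he := hG.elt
  have hl1 := hlam.1
  have hl2 := hlam.2
  have hc : 0 < val Dm ψ Φ (famA π k) lam :=
    hG.apos.trans_le (val_ge hS hG hA (by linarith) (by linarith))
  obtain ⟨Δ', hΔ', H⟩ := coreK hS hG lam (val Dm ψ Φ (famA π k) lam) M 1 (by linarith) (by linarith)
    hc hM one_pos univ isClosed_univ (fun u _ hu hu2 _ => hcon u hu hu2)
  have m0 : 0 < min Δ Δ' := lt_min hΔ hΔ'
  have m1 := min_le_left Δ Δ'
  have m2 := min_le_right Δ Δ'
  obtain ⟨d1, d2⟩ := hd (lam + min Δ Δ' / 2) (by linarith) (by linarith)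
  obtain ⟨_, ⟨γ, hγ, rfl⟩, hb⟩ := val_ex hS hA (lam := lam + min Δ Δ' / 2) (by linarith)
    (x := val Dm ψ Φ (famA π k) lam + (M + 1) * (lam + min Δ Δ' / 2 - lam)) (by nlinarith)
  refine H (lam + min Δ Δ' / 2) (by linarith) (by linarith) k hk univ isClosed_univ (fun _ _ => mem_univ _)
    γ hγ (fun ζ _ => hb _ ⟨ζ, rfl⟩) (fun _ _ _ _ => mem_univ _) ?_
  intro γ' hγ' b' hb'
  have := val_le hS hG hA (lam := lam) (by linarith) ⟨γ', hγ', rfl⟩ (x := b') (by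
    rintro _ ⟨ζ, rfl⟩
    exact hb' ζ (mem_univ _))
  linarith

lemma partA [CompleteSpace X] (hS : Setup Dm ψ Φ) (hG : Geo Dm ψ Φ ρ α ε π)
    (hIB : ∀ a b c : ℝ, 0 < a → a ≤ b →
      IsBounded {u : X | ∃ lam ∈ Icc a b, Crit Dm ψ Φ lam u ∧ ii ψ Φ lam u ≤ c})
    (k : ℕ) (hk : 1 ≤ k) :
    ∃ u, Crit Dm ψ Φ 1 u ∧ ii ψ Φ 1 u = val Dm ψ Φ (famA π k) 1 := by
  have hA := famA_fam hS hG k hk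
  have he := hG.epos
  have hq : ∀ n : ℕ, 0 < ε / ((n : ℝ) + 1) ∧ ε / ((n : ℝ) + 1) ≤ ε := by
    intro n
    have : (0 : ℝ) ≤ n := n.cast_nonneg
    exact ⟨by positivity, div_le_self he.le (by linarith)⟩
  choose l hl u hu hv using fun n : ℕ => levelCrit hS hG k hk 1 (1 + ε / ((n : ℝ) + 1))
    (by linarith) (by linarith [(hq n).1]) (by linarith [(hq n).2])
  have hl1 : Tendsto l atTop (𝓝 1) := by
    refine tendsto_of_tendsto_of_tendsto_of_le_of_le tendsto_const_nhds
      (h := fun n : ℕ => 1 + ε / ((n : ℝ) + 1)) ?_ (fun n => (hl n).1.le) (fun n => (hl n).2.le)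
    have := (tendsto_one_div_add_atTop_nhds_zero_nat (𝕜 := ℝ)).const_mul ε |>.const_add 1
    simpa [div_eq_mul_inv] using this
  have hle : ∀ n, l n ≤ 1 + ε := fun n => by linarith [(hl n).2, (hq n).2]
  have hbd : IsBounded (range u) := by
    refine (hIB 1 (1 + ε) (val Dm ψ Φ (famA π k) (1 + ε)) one_pos (by linarith)).subset ?_
    rintro _ ⟨n, rfl⟩
    refine ⟨l n, ⟨(hl n).1.le, hle n⟩, hu n, ?_⟩
    rw [hv]
    exact val_mono hS hG hA (by linarith [(hl n).1]) (hle n) le_rfl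
  obtain ⟨φ, w, hφ, hw1, hw2, hw3⟩ := hS.lim l 1 one_pos hl1 u (fun n => (hu n).1) hbd (fun _ => 0)
    tendsto_const_nhds (fun n v hv => by
      have := (hu n).2 v hv
      unfold DD
      linarith)
  have hΦc : Continuous Φ := hS.diff.continuous
  have hlφ : Tendsto (fun n => l (φ n)) atTop (𝓝 1) := hl1.comp hφ.tendsto_atTop
  have hlim : Tendsto (fun n => ii ψ Φ (l (φ n)) (u (φ n))) atTop (𝓝 (ii ψ Φ 1 w)) :=
    (hlφ.mul hw2).sub ((hΦc.tendsto w).comp hw1)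
  refine ⟨w, hw3, le_antisymm ?_ ?_⟩
  · refine le_of_forall_gt_imp_ge_of_dense fun x hx => ?_
    obtain ⟨_, ⟨γ, hγ, rfl⟩, hb⟩ := val_ex hS hA (lam := 1) (by linarith) hx
    obtain ⟨B, hB⟩ := (isCompact_range (hΦc.comp γ.continuous)).isBounded.exists_norm_le
    have hlim2 : Tendsto (fun n => x + (l (φ n) - 1) * (x + B)) atTop (𝓝 (x + (1 - 1) * (x + B))) :=
      ((hlφ.sub_const 1).mul_const _).const_add _
    rw [sub_self, zero_mul, add_zero] at hlim2
    refine le_of_tendsto_of_tendsto' hlim hlim2 fun n => ?_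
    rw [hv]
    refine val_le hS hG hA (by linarith [(hl (φ n)).1]) ⟨γ, hγ, rfl⟩ ?_
    rintro _ ⟨ζ, rfl⟩
    refine ⟨(hb _ ⟨ζ, rfl⟩).1, ?_⟩
    have h1 := (hb _ ⟨ζ, rfl⟩).2
    have h2 : |Φ (γ ζ)| ≤ B := hB _ ⟨ζ, rfl⟩
    have h3 := (abs_le.1 h2).2
    have h4 := (hl (φ n)).1
    unfold ii at h1 ⊢
    have h5 : ψ (γ ζ) ≤ x + B := by linarith
    have := mul_le_mul_of_nonneg_left h5 (show 0 ≤ l (φ n) - 1 by linarith)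
    linarith
  · refine ge_of_tendsto' hlim fun n => ?_
    rw [hv]
    exact val_mono hS hG hA (by linarith) (hl _).1.le (hle _)

end SMPAn
namespace SMPAn
variable {Dm : Set X} {ψ Φ : X → ℝ} {ρ α ε : ℝ} {π : (k : ℕ) → EuclideanSpace ℝ (Fin k) → X}

/-- Images of admissible maps on zero sets of odd functions, of codimension defect at least `j`. -/
def famC (π : (k : ℕ) → EuclideanSpace ℝ (Fin k) → X) (j : ℕ) : Set (Set X) :=
  {S | ∃ m, 1 ≤ m ∧ ∃ γ : C(Kb m, X), Adm π m γ ∧ ∃ hs : List C(Kb m, ℝ),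
    (∀ h ∈ hs, ∀ ζ, h (-ζ) = - h ζ) ∧ hs.length + j ≤ m ∧ S = γ '' {ζ | ∀ h ∈ hs, h ζ = 0}}

lemma famC_anti {j j' : ℕ} (h : j ≤ j') : famC π j' ⊆ famC π j := by
  rintro S ⟨m, hm, γ, hγ, hs, h1, h2, h3⟩
  exact ⟨m, hm, γ, hγ, hs, h1, by omega, h3⟩

lemma famA_sub {j k : ℕ} (hk : 1 ≤ k) (h : j ≤ k) : famA π k ⊆ famC π j := by
  rintro S ⟨γ, hγ, rfl⟩
  exact ⟨k, hk, γ, hγ, [], by simp, by simpa using h, by simp⟩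

lemma famC_fam (hS : Setup Dm ψ Φ) (hG : Geo Dm ψ Φ ρ α ε π) (j : ℕ) (hj : 1 ≤ j) :
    Fam Dm ψ Φ ρ ε (famC π j) where
  ne := by
    obtain ⟨S, h1, h2⟩ := (famA_fam hS hG j hj).ne
    exact ⟨S, famA_sub hj le_rfl h1, h2⟩
  link := by
    rintro _ ⟨m, hm, γ, hγ, hs, h1, h2, rfl⟩
    obtain ⟨ζ, h3, h⟩ := LB hG m hm γ hγ hs h1 (by omega)
    exact ⟨γ ζ, ⟨ζ, h3, rfl⟩, h⟩

/-- Compose a functional with an admissible map. -/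
def fcomp {m : ℕ} (γ : C(Kb m, X)) (f : X →L[ℝ] ℝ) : C(Kb m, ℝ) :=
  ⟨fun ζ => f (γ ζ), f.continuous.comp γ.continuous⟩

lemma famC_gap (hS : Setup Dm ψ Φ) (hG : Geo Dm ψ Φ ρ α ε π) (lam : ℝ) (h1 : 1 - ε ≤ lam)
    (h2 : lam ≤ 1 + ε) : ∃ j, 1 ≤ j ∧ -Φ 0 < val Dm ψ Φ (famC π j) lam := by
  obtain ⟨fs, ν, hν, hgap⟩ := hS.gap lam ρ (by linarith [hG.elt]) hG.rpos
  refine ⟨fs.length + 1, by omega, ?_⟩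
  have hC := famC_fam hS hG (fs.length + 1) (by omega)
  have : -Φ 0 + ν ≤ val Dm ψ Φ (famC π (fs.length + 1)) lam := by
    refine le_csInf (val_ne hS hC h2) ?_
    rintro x ⟨_, ⟨m, hm, γ, hγ, hs, h3, h4, rfl⟩, hx⟩
    obtain ⟨ζ, h5, h6⟩ := LB hG m hm γ hγ (hs ++ fs.map (fcomp γ)) (by
        intro h hh ζ
        rcases List.mem_append.1 hh with hh | hh
        · exact h3 h hh ζ
        · obtain ⟨f, hf, rfl⟩ := List.mem_map.1 hh
          simp [fcomp, hγ.1]) (by simp; omega)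
    have h7 := hx (γ ζ) ⟨ζ, fun h hh => h5 h (List.mem_append_left _ hh), rfl⟩
    refine (hgap (γ ζ) h7.1 h6 (fun f hf => ?_)).trans h7.2
    exact h5 (fcomp γ f) (List.mem_append_right _ (List.mem_map.2 ⟨f, hf, rfl⟩))
  linarith

lemma critCompact (hS : Setup Dm ψ Φ) (lam d M : ℝ) (hlam : 0 < lam) :
    IsCompact {u | Crit Dm ψ Φ lam u ∧ ii ψ Φ lam u = d ∧ ψ u ≤ M} := by
  refine IsSeqCompact.isCompact ?_
  intro u hu
  obtain ⟨R, hR⟩ := hS.coer M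
  have hbd : IsBounded (range u) := isBounded_iff_forall_norm_le.2 ⟨R, by
    rintro _ ⟨n, rfl⟩
    exact hR _ (hu n).1.1 (hu n).2.2⟩
  obtain ⟨φ, w, hφ, hw1, hw2, hw3⟩ := hS.lim (fun _ => lam) lam hlam tendsto_const_nhds u
    (fun n => (hu n).1.1) hbd (fun _ => 0) tendsto_const_nhds (fun n v hv => by
      have := (hu n).1.2 v hv
      unfold DD
      linarith)
  refine ⟨w, ⟨hw3, ?_, le_of_tendsto' hw2 fun n => (hu _).2.2⟩, φ, hφ, hw1⟩
  have hΦc : Continuous Φ := hS.diff.continuous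
  have hlim : Tendsto (fun n => ii ψ Φ lam (u (φ n))) atTop (𝓝 (ii ψ Φ lam w)) :=
    (hw2.const_mul lam).sub ((hΦc.tendsto w).comp hw1)
  refine tendsto_nhds_unique hlim ?_
  simp only [(hu _).2.1]
  exact tendsto_const_nhds

lemma sep_list (K : Set X) (hK : IsCompact K) (h0 : (0 : X) ∉ K) :
    ∃ gs : List (X →L[ℝ] ℝ), ∃ δ > 0, ∀ u ∈ thickening δ K, ∃ g ∈ gs, g u ≠ 0 := by
  classical
  obtain ⟨t, ht⟩ := hK.elim_finite_subcover (fun f : X →L[ℝ] ℝ => {u | f u ≠ 0})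
    (fun f => isOpen_ne_fun f.continuous continuous_const) (by
      intro u hu
      by_contra hcon
      refine h0 ?_
      have : u = 0 := by
        refine SeparatingDual.eq_zero_of_forall_dual_eq_zero (R := ℝ) fun f => ?_
        by_contra hf
        exact hcon (mem_iUnion.2 ⟨f, hf⟩)
      rwa [this] at hu)
  have ho : IsOpen (⋃ f ∈ t, {u : X | f u ≠ 0}) :=
    isOpen_biUnion fun f _ => isOpen_ne_fun f.continuous continuous_const
  obtain ⟨δ, hδ, h⟩ := hK.exists_thickening_subset_open ho ht
  refine ⟨t.toList, δ, hδ, fun u hu => ?_⟩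
  obtain ⟨f, hf, hfu⟩ := mem_iUnion₂.1 (h hu)
  exact ⟨f, by simpa using hf, hfu⟩

lemma partC [CompleteSpace X] (hS : Setup Dm ψ Φ) (hG : Geo Dm ψ Φ ρ α ε π) :
    Tendsto (fun k => val Dm ψ Φ (famA π k) 1) atTop atTop := by
  by_contra hcon
  rw [Filter.tendsto_atTop] at hcon
  push Not at hcon
  obtain ⟨b, hb⟩ := hcon
  have he := hG.epos
  have he1 := hG.elt
  have hfam : ∀ j, Fam Dm ψ Φ ρ ε (famC π (j + 1)) := fun j => famC_fam hS hG (j + 1) (by omega)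
  have hub : ∀ lam, 1 - ε ≤ lam → lam ≤ 1 → ∀ j, val Dm ψ Φ (famC π (j + 1)) lam ≤ b := by
    intro lam h1 h2 j
    obtain ⟨k, hk, hkb⟩ := (frequently_atTop.1 hb) (j + 1)
    have h3 := val_anti hS hG (hfam j) (famA_fam hS hG k (by omega)) (famA_sub (by omega) hk)
      (l := 1) (by linarith) (by linarith)
    have h4 := val_mono hS hG (hfam j) h1 h2 (by linarith)
    linarith
  have hbdd : ∀ lam, 1 - ε ≤ lam → lam ≤ 1 →
      BddAbove (range fun j => val Dm ψ Φ (famC π (j + 1)) lam) := by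
    intro lam h1 h2
    refine ⟨b, ?_⟩
    rintro _ ⟨j, rfl⟩
    exact hub lam h1 h2 j
  set D : ℝ → ℝ := fun lam => ⨆ j : ℕ, val Dm ψ Φ (famC π (j + 1)) lam with hD
  have hle : ∀ lam, 1 - ε ≤ lam → lam ≤ 1 → ∀ j, val Dm ψ Φ (famC π (j + 1)) lam ≤ D lam :=
    fun lam h1 h2 j => le_ciSup (hbdd lam h1 h2) j
  obtain ⟨lam, hlam, M, hM, Δ, hΔ, hd⟩ := mono_pt D (1 - ε) 1 (by linarith) (by
    intro x hx y hy hxy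
    refine ciSup_le fun j => ?_
    exact (val_mono hS hG (hfam j) hx.1 hxy (by linarith [hy.2])).trans (hle y hy.1 hy.2 j))
  have hl1 := hlam.1
  have hl2 := hlam.2
  have hdpos : 0 < D lam :=
    hG.apos.trans_le ((val_ge hS hG (hfam 0) hl1.le (by linarith)).trans (hle lam hl1.le hl2.le 0))
  have hdgap : -Φ 0 < D lam := by
    obtain ⟨j, hj, h⟩ := famC_gap hS hG lam hl1.le (by linarith)
    obtain ⟨i, rfl⟩ : ∃ i, j = i + 1 := ⟨j - 1, by omega⟩
    exact h.trans_le (hle lam hl1.le hl2.le i)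
  obtain ⟨gs, δ, hδ, hgs⟩ := sep_list _ (critCompact hS lam (D lam) (M + 2) (by linarith)) (by
    rintro ⟨-, h, -⟩
    rw [ii, hS.psi0] at h
    linarith)
  set K0 := {u | Crit Dm ψ Φ lam u ∧ ii ψ Φ lam u = D lam ∧ ψ u ≤ M + 2} with hK0
  obtain ⟨Δ', hΔ', H⟩ := coreK hS hG lam (D lam) M (δ / 2) (by linarith) (by linarith)
    hdpos hM (by linarith) (thickening (δ / 2) K0)ᶜ isOpen_thickening.isClosed_compl
    (fun u hu hu1 hu2 hu3 => hu (self_subset_thickening (by linarith) _ ⟨hu1, hu2, hu3⟩))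
  have m0 : 0 < min Δ Δ' := lt_min hΔ hΔ'
  have m1 := min_le_left Δ Δ'
  have m2 := min_le_right Δ Δ'
  obtain ⟨ℓ, hℓ0, hℓ1, hℓ2⟩ : ∃ ℓ > 0, ℓ < Δ ∧ ℓ < Δ' :=
    ⟨min Δ Δ' / 2, by linarith, by linarith, by linarith⟩
  obtain ⟨d1, d2⟩ := hd (lam + ℓ) (by linarith) (by linarith)
  obtain ⟨j, hj⟩ := exists_lt_of_lt_ciSup (show D lam - ℓ / 2 < ⨆ j : ℕ, val Dm ψ Φ (famC π (j + 1)) lam by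
    change _ < D lam
    linarith)
  have h3 := hle (lam + ℓ) (by linarith) d1 (j + gs.length)
  obtain ⟨_, ⟨m, hm, γ, hγ, hs, hs1, hs2, rfl⟩, hb2⟩ := val_ex hS (hfam (j + gs.length))
    (lam := lam + ℓ) (by linarith) (x := D lam + (M + 1) * (lam + ℓ - lam)) (by nlinarith)
  refine H (lam + ℓ) (by linarith) (by linarith) m hm
    {ζ | ∀ h ∈ hs ++ gs.map (fcomp γ), h ζ = 0} ?_ ?_ γ hγ ?_ ?_ ?_
  · have : {ζ | ∀ h ∈ hs ++ gs.map (fcomp γ), h ζ = 0} =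
        ⋂ h ∈ {h | h ∈ hs ++ gs.map (fcomp γ)}, {ζ : Kb m | h ζ = 0} := by
      ext ζ; simp only [mem_iInter]; rfl
    rw [this]
    exact isClosed_biInter fun h _ => isClosed_eq h.continuous continuous_const
  · intro ζ hζ h hh
    have h0 := hζ h hh
    rcases List.mem_append.1 hh with hh | hh
    · rw [hs1 h hh, h0, neg_zero]
    · obtain ⟨f, hf, rfl⟩ := List.mem_map.1 hh
      simp only [fcomp, ContinuousMap.coe_mk] at h0 ⊢
      rw [hγ.1, map_neg, h0, neg_zero]
  · intro ζ hζ
    exact hb2 _ ⟨ζ, fun h hh => hζ h (List.mem_append_left _ hh), rfl⟩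
  · intro ζ hζ x hx hxT
    obtain ⟨z, hz, hxz⟩ := mem_thickening_iff.1 hxT
    obtain ⟨g, hg, hne⟩ := hgs (γ ζ) (mem_thickening_iff.2 ⟨z, hz, by
      have := dist_triangle (γ ζ) x z
      rw [dist_comm (γ ζ) x, dist_eq_norm x] at this
      linarith⟩)
    exact hne (hζ (fcomp γ g) (List.mem_append_right _ (List.mem_map.2 ⟨g, hg, rfl⟩)))
  · intro γ' hγ' b' hb'
    have := val_le hS hG (hfam j) (lam := lam) hl1.le
      (S := Set.image γ' {ζ | ∀ h ∈ hs ++ gs.map (fcomp γ), h ζ = 0})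
      ⟨m, hm, γ', hγ', hs ++ gs.map (fcomp γ), by
        intro h hh ζ
        rcases List.mem_append.1 hh with hh | hh
        · exact hs1 h hh ζ
        · obtain ⟨f, hf, rfl⟩ := List.mem_map.1 hh
          simp [fcomp, hγ.1], by simp; omega, rfl⟩ (x := b') (by
        rintro _ ⟨ζ, hζ, rfl⟩
        exact hb' ζ hζ)
    linarith

end SMPAn
namespace SMPFin

section FinSec
variable {Ψ : X → EReal} {Φ : X → ℝ}

/-- Effective domain. -/
def dom (Ψ : X → EReal) : Set X := {u | Ψ u ≠ ⊤}

/-- Real part of the functional. -/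
def re (Ψ : X → EReal) (u : X) : ℝ := (Ψ u).toReal

lemma coe_re (hnn : ∀ u, 0 ≤ Ψ u) {u : X} (hu : u ∈ dom Ψ) : ((re Ψ u : ℝ) : EReal) = Ψ u :=
  EReal.coe_toReal hu (fun h => by have := hnn u; rw [h] at this; simp at this)

lemma ILam_coe (hnn : ∀ u, 0 ≤ Ψ u) {u : X} (hu : u ∈ dom Ψ) (lam : ℝ) :
    ILam Ψ Φ lam u = ((SMPAn.ii (re Ψ) Φ lam u : ℝ) : EReal) := by
  rw [ILam, ← coe_re hnn hu, SMPAn.ii]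
  push_cast
  rfl

lemma ILam_top {u : X} (hu : u ∉ dom Ψ) {lam : ℝ} (hl : 0 < lam) : ILam Ψ Φ lam u = ⊤ := by
  have h : Ψ u = ⊤ := by
    by_contra h
    exact hu h
  rw [ILam, h, EReal.coe_mul_top_of_pos hl, EReal.top_sub_coe]

lemma ILam_le (hnn : ∀ u, 0 ≤ Ψ u) {u : X} {lam : ℝ} (hl : 0 < lam) (x : ℝ) :
    ILam Ψ Φ lam u ≤ (x : EReal) ↔ u ∈ dom Ψ ∧ SMPAn.ii (re Ψ) Φ lam u ≤ x := by
  by_cases hu : u ∈ dom Ψ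
  · rw [ILam_coe hnn hu, EReal.coe_le_coe_iff]
    simp [hu]
  · rw [ILam_top hu hl]
    simp [hu]

lemma crit_iff (h0 : Ψ 0 = 0) (hnn : ∀ u, 0 ≤ Ψ u) {u : X} {lam : ℝ} (hl : 0 < lam) :
    IsCriticalPoint Ψ Φ lam u ↔ SMPAn.Crit (dom Ψ) (re Ψ) Φ lam u := by
  have key : ∀ v ∈ dom Ψ, u ∈ dom Ψ →
      ((0 ≤ (lam : EReal) * (Ψ v - Ψ u) - ((fderiv ℝ Φ u (v - u) : ℝ) : EReal)) ↔
        fderiv ℝ Φ u (v - u) ≤ lam * (re Ψ v - re Ψ u)) := by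
    intro v hv hu
    rw [← coe_re hnn hv, ← coe_re hnn hu]
    rw [← EReal.coe_sub, ← EReal.coe_mul, ← EReal.coe_sub, ← EReal.coe_zero, EReal.coe_le_coe_iff]
    exact sub_nonneg
  constructor
  · intro h
    have hu : u ∈ dom Ψ := by
      intro hu
      have h1 := h 0
      rw [hu, h0, EReal.sub_top, EReal.coe_mul_bot_of_pos hl, EReal.bot_sub] at h1
      simp at h1
    exact ⟨hu, fun v hv => (key v hv hu).1 (h v)⟩
  · intro h v
    by_cases hv : v ∈ dom Ψ
    · exact (key v hv h.1).2 (h.2 v hv)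
    · have hv' : Ψ v = ⊤ := by
        by_contra h
        exact hv h
      rw [hv', ← coe_re hnn h.1, EReal.top_sub_coe, EReal.coe_mul_top_of_pos hl, EReal.top_sub_coe]
      exact le_top

lemma smp_eq (hnn : ∀ u, 0 ≤ Ψ u) (k : ℕ)
    (π : (k : ℕ) → EuclideanSpace ℝ (Fin k) → X) :
    smpValue Ψ Φ k (π k) 1 = SMPAn.val (dom Ψ) (re Ψ) Φ (SMPAn.famA π k) 1 := by
  unfold smpValue SMPAn.val
  congr 1
  ext x
  constructor
  · rintro ⟨γ, ⟨h1, h2, h3⟩, h4⟩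
    refine ⟨_, ⟨⟨fun ζ : SMPAn.Kb k => γ ζ, h1.restrict⟩, ⟨fun ζ => ?_, fun ζ hζ => ?_⟩, rfl⟩, ?_⟩
    · exact h2 ζ ζ.2
    · exact h3 ζ (mem_sphere_zero_iff_norm.2 hζ)
    · rintro _ ⟨ζ, rfl⟩
      exact (ILam_le hnn one_pos x).1 (h4 ζ ζ.2)
  · rintro ⟨_, ⟨γ, ⟨h1, h2⟩, rfl⟩, h3⟩
    refine ⟨fun ζ => γ (SMPAn.rr k ζ), ⟨?_, ?_, ?_⟩, ?_⟩
    · exact (γ.continuous.comp (SMPAn.rr k).continuous).continuousOn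
    · intro ζ _
      simp only [SMPAn.rr_neg, h1]
    · intro ζ hζ
      have hm : ζ ∈ closedBall (0 : EuclideanSpace ℝ (Fin k)) 1 := sphere_subset_closedBall hζ
      have := SMPAn.rr_coe (⟨ζ, hm⟩ : SMPAn.Kb k)
      simp only at this
      simp only [this]
      exact h2 ⟨ζ, hm⟩ (mem_sphere_zero_iff_norm.1 hζ)
    · intro ζ _
      exact (ILam_le hnn one_pos x).2 (h3 _ ⟨_, rfl⟩)

lemma mkSetup
    (hΨ0 : Ψ 0 = 0)
    (hΨnn : ∀ u : X, 0 ≤ Ψ u)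
    (hΨlsc : LowerSemicontinuous Ψ)
    (hΨconv : ∀ u v : X, ∀ a b : ℝ, 0 ≤ a → 0 ≤ b → a + b = 1 →
      Ψ (a • u + b • v) ≤ (a : EReal) * Ψ u + (b : EReal) * Ψ v)
    (hΨcoer : ∀ C : ℝ, ∃ R : ℝ, ∀ u : X, R ≤ ‖u‖ → (C : EReal) ≤ Ψ u)
    (hΨ3 : ∀ (u : ℕ → X) (w : X), (∀ j, Ψ (u j) ≠ ⊤) → Ψ w ≠ ⊤ →
      (∀ f : X →L[ℝ] ℝ, Tendsto (fun j => f (u j)) atTop (𝓝 (f w))) →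
      Tendsto (fun j => Ψ (u j)) atTop (𝓝 (Ψ w)) →
      Tendsto (fun j => ‖u j - w‖) atTop (𝓝 0))
    (hΦ : ContDiff ℝ 1 Φ)
    (hΦ2 : ∀ u : ℕ → X, IsBounded (range u) →
      ∃ (φ : ℕ → ℕ) (w : X), StrictMono φ ∧
        (∀ f : X →L[ℝ] ℝ, Tendsto (fun j => f (u (φ j))) atTop (𝓝 (f w))) ∧
        ∀ v : X, ((fderiv ℝ Φ w (v - w) : ℝ) : EReal) ≤
          Filter.liminf
            (fun j => ((fderiv ℝ Φ (u (φ j)) (v - u (φ j)) : ℝ) : EReal)) atTop)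
    (hΨeven : ∀ u : X, Ψ (-u) = Ψ u)
    (hΦeven : ∀ u : X, Φ (-u) = Φ u) : SMPAn.Setup (dom Ψ) (re Ψ) Φ where
  zero_mem := by
    change Ψ 0 ≠ ⊤
    rw [hΨ0]; simp
  psi0 := by rw [re, hΨ0]; simp
  nn := fun u => EReal.toReal_nonneg (hΨnn u)
  conv := by
    intro u hu v hv a b ha hb hab
    have h := hΨconv u v a b ha hb hab
    rw [← coe_re hΨnn hu, ← coe_re hΨnn hv, ← EReal.coe_mul, ← EReal.coe_mul, ← EReal.coe_add] at h
    have hm : a • u + b • v ∈ dom Ψ := by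
      intro ht
      rw [ht] at h
      exact (EReal.coe_lt_top _).not_ge h
    refine ⟨hm, ?_⟩
    rwa [← coe_re hΨnn hm, EReal.coe_le_coe_iff] at h
  closed := by
    intro a
    have : {u | u ∈ dom Ψ ∧ re Ψ u ≤ a} = Ψ ⁻¹' Iic (a : EReal) := by
      ext u
      constructor
      · rintro ⟨h1, h2⟩
        change Ψ u ≤ a
        rwa [← coe_re hΨnn h1, EReal.coe_le_coe_iff]
      · intro h
        have h' : Ψ u ≤ a := h
        have hm : u ∈ dom Ψ := by
          intro ht
          rw [ht] at h'
          exact (EReal.coe_lt_top _).not_ge h'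
        refine ⟨hm, ?_⟩
        rwa [← coe_re hΨnn hm, EReal.coe_le_coe_iff] at h'
    rw [this]
    exact hΨlsc.isClosed_preimage _
  coer := by
    intro C
    obtain ⟨R, hR⟩ := hΨcoer (C + 1)
    refine ⟨R, fun u hu hC => ?_⟩
    by_contra hcon
    have h := hR u (not_le.1 hcon).le
    rw [← coe_re hΨnn hu, EReal.coe_le_coe_iff] at h
    linarith
  h3 := by
    intro u w hu hw h1 h2
    rw [tendsto_iff_norm_sub_tendsto_zero]
    refine hΨ3 u w hu hw h1 ?_
    have h3 := (continuous_coe_real_ereal.tendsto (re Ψ w)).comp h2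
    rw [coe_re hΨnn hw] at h3
    refine h3.congr fun j => ?_
    exact coe_re hΨnn (hu j)
  diff := hΦ
  h2 := by
    intro u hu
    obtain ⟨φ, w, h1, h2, h3⟩ := hΦ2 u hu
    refine ⟨φ, w, h1, h2, fun v r hr => ?_⟩
    have h4 : (r : EReal) < _ := (EReal.coe_lt_coe_iff.2 hr).trans_le (h3 v)
    filter_upwards [Filter.eventually_lt_of_lt_liminf h4] with j hj
    exact EReal.coe_lt_coe_iff.1 hj
  psiE := by intro u; rw [re, re, hΨeven]
  DmE := by
    intro u hu
    change Ψ (-u) ≠ ⊤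
    rw [hΨeven]
    exact hu
  phiE := hΦeven

end FinSec

end SMPFin

theorem symmetric_mountain_pass_theorem
    [CompleteSpace X]
    (Ψ : X → EReal) (Φ : X → ℝ)
    -- (Ψ1)
    (hΨ0 : Ψ 0 = 0)
    (hΨnn : ∀ u : X, 0 ≤ Ψ u)
    (hΨlsc : LowerSemicontinuous Ψ)
    (hΨconv : ∀ u v : X, ∀ a b : ℝ, 0 ≤ a → 0 ≤ b → a + b = 1 →
      Ψ (a • u + b • v) ≤ (a : EReal) * Ψ u + (b : EReal) * Ψ v)
    -- (Ψ2)
    (hΨcoer : ∀ C : ℝ, ∃ R : ℝ, ∀ u : X, R ≤ ‖u‖ → (C : EReal) ≤ Ψ u)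
    -- (Ψ3)
    (hΨ3 : ∀ (u : ℕ → X) (w : X), (∀ j, Ψ (u j) ≠ ⊤) → Ψ w ≠ ⊤ →
      (∀ f : X →L[ℝ] ℝ, Tendsto (fun j => f (u j)) atTop (𝓝 (f w))) →
      Tendsto (fun j => Ψ (u j)) atTop (𝓝 (Ψ w)) →
      Tendsto (fun j => ‖u j - w‖) atTop (𝓝 0))
    -- (Φ1)
    (hΦ : ContDiff ℝ 1 Φ)
    -- (Φ2)
    (hΦ2 : ∀ u : ℕ → X, IsBounded (range u) →
      ∃ (φ : ℕ → ℕ) (w : X), StrictMono φ ∧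
        (∀ f : X →L[ℝ] ℝ, Tendsto (fun j => f (u (φ j))) atTop (𝓝 (f w))) ∧
        ∀ v : X, ((fderiv ℝ Φ w (v - w) : ℝ) : EReal) ≤
          Filter.liminf
            (fun j => ((fderiv ℝ Φ (u (φ j)) (v - u (φ j)) : ℝ) : EReal)) atTop)
    -- (IB)
    (hIB : ∀ a b c : ℝ, 0 < a → a ≤ b →
      IsBounded {u : X | ∃ lam ∈ Icc a b,
        IsCriticalPoint Ψ Φ lam u ∧ ILam Ψ Φ lam u ≤ (c : EReal)})
    -- (E): evenness
    (hΨeven : ∀ u : X, Ψ (-u) = Ψ u)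
    (hΦeven : ∀ u : X, Φ (-u) = Φ u)
    -- (SMP)
    (ρ₀ α₀ ε : ℝ) (π : (k : ℕ) → EuclideanSpace ℝ (Fin k) → X)
    (hρ₀ : 0 < ρ₀) (hα₀ : 0 < α₀) (hε : 0 < ε)
    (hinf : (⨅ u ∈ {u : X | ‖u‖ = ρ₀}, ILam Ψ Φ (1 - ε) u) = (α₀ : EReal))
    (hπcont : ∀ k : ℕ, 1 ≤ k →
      ContinuousOn (π k) (sphere (0 : EuclideanSpace ℝ (Fin k)) 1))
    (hπodd : ∀ k : ℕ, 1 ≤ k →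
      ∀ ζ ∈ sphere (0 : EuclideanSpace ℝ (Fin k)) 1, π k (-ζ) = - π k ζ)
    (hπnorm : ∀ k : ℕ, 1 ≤ k →
      ∀ ζ ∈ sphere (0 : EuclideanSpace ℝ (Fin k)) 1, ρ₀ < ‖π k ζ‖)
    (hπneg : ∀ k : ℕ, 1 ≤ k → ∃ β : ℝ, β < 0 ∧
      ∀ ζ ∈ sphere (0 : EuclideanSpace ℝ (Fin k)) 1,
        ILam Ψ Φ (1 + ε) (π k ζ) ≤ (β : EReal)) :
    ∃ u : ℕ → X,
      (∀ k : ℕ, 1 ≤ k → IsCriticalPoint Ψ Φ 1 (u k) ∧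
        ILam Ψ Φ 1 (u k) = ((smpValue Ψ Φ k (π k) 1 : ℝ) : EReal)) ∧
      Tendsto (fun k : ℕ => smpValue Ψ Φ k (π k) 1) atTop atTop := by
  have hS := SMPFin.mkSetup hΨ0 hΨnn hΨlsc hΨconv hΨcoer hΨ3 hΦ hΦ2 hΨeven hΦeven
  have hG : SMPAn.Geo (SMPFin.dom Ψ) (SMPFin.re Ψ) Φ ρ₀ α₀ (min ε (1 / 2)) π := by
    have e1 := min_le_left ε (1 / 2)
    have e2 := min_le_right ε (1 / 2)
    have hd : ∀ k : ℕ, 1 ≤ k → ∀ ζ ∈ sphere (0 : EuclideanSpace ℝ (Fin k)) 1,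
        π k ζ ∈ SMPFin.dom Ψ ∧ SMPAn.ii (SMPFin.re Ψ) Φ (1 + ε) (π k ζ) ≤ 0 := by
      intro k hk ζ hζ
      obtain ⟨β, hβ, h⟩ := hπneg k hk
      have h1 := (SMPFin.ILam_le hΨnn (by linarith) β).1 (h ζ hζ)
      exact ⟨h1.1, h1.2.trans hβ.le⟩
    refine ⟨hρ₀, hα₀, lt_min hε (by norm_num), by linarith, ?_, hπcont, hπodd, hπnorm,
      fun k hk ζ hζ => (hd k hk ζ hζ).1, fun k hk ζ hζ => ?_⟩
    · intro u hu hn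
      have h1 : (α₀ : EReal) ≤ ILam Ψ Φ (1 - ε) u := by
        rw [← hinf]
        exact iInf₂_le u hn
      rw [SMPFin.ILam_coe hΨnn hu, EReal.coe_le_coe_iff] at h1
      exact h1.trans (SMPAn.ii_mono hS (by linarith) u)
    · exact (SMPAn.ii_mono hS (by linarith) _).trans (hd k hk ζ hζ).2
  have hIB' : ∀ a b c : ℝ, 0 < a → a ≤ b →
      IsBounded {u : X | ∃ lam ∈ Icc a b, SMPAn.Crit (SMPFin.dom Ψ) (SMPFin.re Ψ) Φ lam u ∧
        SMPAn.ii (SMPFin.re Ψ) Φ lam u ≤ c} := by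
    intro a b c ha hab
    refine (hIB a b c ha hab).subset ?_
    rintro u ⟨lam, hl, h1, h2⟩
    have hl0 : 0 < lam := ha.trans_le hl.1
    exact ⟨lam, hl, (SMPFin.crit_iff hΨ0 hΨnn hl0).2 h1, (SMPFin.ILam_le hΨnn hl0 c).2 ⟨h1.1, h2⟩⟩
  have hex : ∀ k : ℕ, ∃ u : X, 1 ≤ k → IsCriticalPoint Ψ Φ 1 u ∧
      ILam Ψ Φ 1 u = ((smpValue Ψ Φ k (π k) 1 : ℝ) : EReal) := by
    intro k
    by_cases hk : 1 ≤ k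
    · obtain ⟨u, h1, h2⟩ := SMPAn.partA hS hG hIB' k hk
      refine ⟨u, fun _ => ⟨(SMPFin.crit_iff hΨ0 hΨnn one_pos).2 h1, ?_⟩⟩
      rw [SMPFin.ILam_coe hΨnn h1.1, h2, SMPFin.smp_eq hΨnn]
    · exact ⟨0, fun h => absurd h hk⟩
  choose u hu using hex
  refine ⟨u, hu, ?_⟩
  refine (SMPAn.partC hS hG).congr fun k => ?_
  exact (SMPFin.smp_eq hΨnn k π).symm

end
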